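/- arXiv:1510.00218 — 3 statements merged into one kernel-verified Lean document; each statement's English description precedes it below -/
import Mathlib

section
/- Let K be a field of characteristic p equipped with a family of maps (D_𝐢 : K → K)_{𝐢∈ℕ^e} with D_(0,…,0) = id satisfying the defining relations D_𝐢 = D_{i_1·𝐞_1} ∘ (D_{i_2·𝐞_1})^(p) ∘ … ∘ (D_{i_e·𝐞_1})^(p^{e−1}) for every 𝐢 = (i_1,…,i_e) ∈ ℕ^e, and write D_n := D_{n·𝐞_1} for n ∈ ℕ. Then (K, (D_𝐢)) is a model of W_e-DCF if and only if K is separably closed and the sequence (D_n)_{n∈ℕ} satisfies: (H1') each D_n is additive; (H2') D_n(xy) = Σ_{k+l=n} D_k(x)·D_l(y); (H3') D_i ∘ D_j = D_j ∘ D_i for all i, j; (H4') D_n^(p^e) = 0 for every n ≥ 1; (H5') there exists x ∈ K with D_1^(p^e−1)(x) ≠ 0; (H6') ker D_1 ⊆ K^p; (H8') for all 𝐢 = (i_1,…,i_e), 𝐣 = (j_1,…,j_e) ∈ ℕ^e: D_{i_1} ∘ D_{i_2}^(p) ∘ … ∘ D_{i_e}^(p^{e−1}) ∘ D_{j_1}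 ∘ … ∘ D_{j_e}^(p^{e−1}) = Σ_𝐥 α_{𝐢,𝐣}(𝐥) · D_{l_1} ∘ D_{l_2}^(p) ∘ … ∘ D_{l_e}^(p^{e−1}). -/
noncomputable section

open scoped BigOperators

/-- The `m`-th Witt addition polynomial with coefficients reduced mod `p`. -/
def wittHmod (p : ℕ) [Fact p.Prime] (m : ℕ) : MvPolynomial (Fin 2 × ℕ) (ZMod p) :=
  MvPolynomial.map (Int.castRingHom (ZMod p)) (WittVector.wittAdd p m)

/-- The exponent (as a finitely supported function) of the monomial `X̄^i * Ȳ^j`,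
where `X_{m+1}` is the variable `(0, m)` and `Y_{m+1}` is the variable `(1, m)`. -/
def xyExp (e : ℕ) (i j : Fin e → ℕ) : (Fin 2 × ℕ) →₀ ℕ :=
  ∑ m : Fin e, (Finsupp.single ((0 : Fin 2), (m : ℕ)) (i m) +
    Finsupp.single ((1 : Fin 2), (m : ℕ)) (j m))

/-- `wittAlpha p e i j l` is the coefficient `α_{i,j}(l) ∈ 𝔽_p` of the monomial `X̄^i * Ȳ^j` in
`H_1^{l_1} ⋯ H_e^{l_e}`, where `H_1, …, H_e` are the polynomials giving the group law of the
`e`-dimensional Witt group over `𝔽_p`. -/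
def wittAlpha (p : ℕ) [Fact p.Prime] (e : ℕ) (i j l : Fin e → ℕ) : ZMod p :=
  MvPolynomial.coeff (xyExp e i j) (∏ m : Fin e, (wittHmod p (m : ℕ)) ^ (l m))

/-- `(K, D)` is a model of `W_e`-DCF:  `K` is a separably closed field of characteristic `p` with
`[K : K^p] = p^e` (where `K^p` is the subfield of `p`-th powers, i.e. the range of the Frobenius)
and `D` is a strict `W_e`-iterative Hasse–Schmidt derivation of dimension `e`.  Multi-indices
`𝐢 ∈ ℕ^e` are represented as functions `Fin e → ℕ`, and the scalars `α_{𝐢,𝐣}(𝐥) ∈ 𝔽_p` act on `K`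
via `ZMod.cast` (the iterated sum of `1`). -/
def IsWeDCF (p e : ℕ) [Fact p.Prime] (K : Type*) [Field K] [CharP K p]
    (D : (Fin e → ℕ) → K → K) : Prop :=
  IsSepClosed K ∧
  Module.finrank ↥(RingHom.fieldRange (frobenius K p)) K = p ^ e ∧
  D 0 = id ∧
  (∀ i : Fin e → ℕ, ∀ x y : K, D i (x + y) = D i x + D i y) ∧
  (∀ i : Fin e → ℕ, ∀ x y : K, D i (x * y) =
     ∑ k ∈ Finset.Iic i, D k x * D (i - k) y) ∧
  (∀ i j : Fin e → ℕ, ∀ x : K,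
     D i (D j x) = ∑ᶠ l : Fin e → ℕ, ZMod.cast (wittAlpha p e i j l) * D l x) ∧
  (∀ x : K, (∀ m : Fin e, D (Pi.single m 1) x = 0) ↔ ∃ y : K, x = y ^ p)

/-- `hsComp p e D v` is the composition
`D_{v_1} ∘ (D_{v_2})^(p) ∘ (D_{v_3})^(p^2) ∘ … ∘ (D_{v_e})^(p^{e-1})`
of iterates of the one-variable operators `D_n : K → K`. -/
def hsComp {K : Type*} (p e : ℕ) (D : ℕ → K → K) (v : Fin e → ℕ) : K → K :=
  (List.ofFn fun m : Fin e => (D (v m))^[p ^ (m : ℕ)]).foldr (· ∘ ·) id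

section WittCoefficients

open MvPolynomial

lemma wittHmod_rename_swap (p : ℕ) [Fact p.Prime] (m : ℕ) :
    rename (Prod.map (Equiv.swap (0 : Fin 2) 1) id) (wittHmod p m) = wittHmod p m := by
  have key : rename (Prod.map (Equiv.swap (0 : Fin 2) 1) id) (WittVector.wittAdd p m) =
      WittVector.wittAdd p m := by
    let x : WittVector p (MvPolynomial (Fin 2 × ℕ) ℤ) := WittVector.mk p fun n => X (0, n)
    let y : WittVector p (MvPolynomial (Fin 2 × ℕ) ℤ) := WittVector.mk p fun n => X (1, n)
    have h1 : (x + y).coeff m = WittVector.wittAdd p m := by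
      rw [WittVector.add_coeff, WittVector.peval]
      conv_rhs => rw [← aeval_X_left_apply (R := ℤ) (WittVector.wittAdd p m)]
      congr 2
      ext ⟨a, n⟩
      fin_cases a <;> simp [x, y]
    have h2 : (y + x).coeff m =
        rename (Prod.map (Equiv.swap (0 : Fin 2) 1) id) (WittVector.wittAdd p m) := by
      have hr : rename (R := ℤ) (Prod.map (Equiv.swap (0 : Fin 2) 1) (id : ℕ → ℕ)) =
          aeval fun q => X (Prod.map (Equiv.swap (0 : Fin 2) 1) id q) :=
        algHom_ext fun q => by rw [rename_X, aeval_X]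
      rw [WittVector.add_coeff, WittVector.peval, hr]
      congr 2
      ext ⟨a, n⟩
      fin_cases a <;> simp [x, y]
    rw [← h2, add_comm, h1]
  rw [wittHmod, ← map_rename, key]

lemma wittAlpha_comm (p : ℕ) [Fact p.Prime] (e : ℕ) (i j l : Fin e → ℕ) :
    wittAlpha p e i j l = wittAlpha p e j i l := by
  have hinj : Function.Injective (Prod.map (Equiv.swap (0 : Fin 2) 1) (id : ℕ → ℕ)) :=
    (Equiv.injective _).prodMap Function.injective_id
  have hexp : (xyExp e i j).mapDomain (Prod.map (Equiv.swap (0 : Fin 2) 1) id) = xyExp e j i := by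
    simp only [xyExp, Finsupp.mapDomain_finsetSum, Finsupp.mapDomain_add,
      Finsupp.mapDomain_single, Prod.map_apply, Equiv.swap_apply_left, Equiv.swap_apply_right, id]
    exact Finset.sum_congr rfl fun m _ => add_comm _ _
  have hprod : rename (Prod.map (Equiv.swap (0 : Fin 2) 1) id)
      (∏ m : Fin e, wittHmod p (m : ℕ) ^ l m) = ∏ m : Fin e, wittHmod p (m : ℕ) ^ l m := by
    simp only [map_prod, map_pow, wittHmod_rename_swap]
  rw [wittAlpha, wittAlpha, ← hexp, ← hprod, coeff_rename_mapDomain _ hinj, hprod]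

lemma killCompl_wittHmod (p : ℕ) [Fact p.Prime] (N m : ℕ) (hm : m ≤ N)
    (hf : Function.Injective fun a : Fin 2 => (a, N)) :
    killCompl hf (wittHmod p m) = if m = N then X 0 + X 1 else 0 := by
  let w : Fin 2 → WittVector p (MvPolynomial (Fin 2) (ZMod p)) := fun a =>
    WittVector.verschiebung^[N] (WittVector.mk p fun n => if n = 0 then X a else 0)
  have hw : ∀ a n, (w a).coeff n = if n = N then X a else 0 := by
    intro a n
    rcases lt_or_ge n N with h | h
    · rw [WittVector.iterate_verschiebung_coeff_eq_zero _ h, if_neg h.ne]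
    · obtain ⟨k, rfl⟩ := Nat.exists_eq_add_of_le' h
      rw [WittVector.iterate_verschiebung_coeff]
      simp
  have h1 : killCompl hf (wittHmod p m) = (w 0 + w 1).coeff m := by
    rw [WittVector.add_coeff, WittVector.peval, wittHmod, aeval_def,
      ← AlgHom.coe_toRingHom, ← RingHom.comp_apply, ← coe_eval₂Hom]
    refine DFunLike.congr_fun (ringHom_ext' (RingHom.ext_int _ _) ?_) (WittVector.wittAdd p m)
    rintro ⟨a, n⟩
    have hX : killCompl hf (X (a, n) : MvPolynomial (Fin 2 × ℕ) (ZMod p)) = (w a).coeff n := by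
      rw [hw]
      split_ifs with h
      · subst h
        simpa using killCompl_rename_app hf (X a : MvPolynomial (Fin 2) (ZMod p))
      · rw [killCompl, aeval_X, dif_neg]
        rintro ⟨b, hb⟩
        exact h (Prod.mk.inj hb).2.symm
    fin_cases a <;> simpa using hX
  have h2 : (w 0 + w 1) = WittVector.verschiebung^[N]
      ((WittVector.mk p fun n => if n = 0 then X 0 else 0) +
        (WittVector.mk p fun n => if n = 0 then X 1 else 0)) :=
     (iterate_map_add WittVector.verschiebung N _ _).symm
  rw [h1, h2]
  split_ifs with h
  · subst h
    have := WittVector.iterate_verschiebung_coeff (p := p)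
      ((WittVector.mk p fun n => if n = 0 then X 0 else 0) +
        (WittVector.mk p fun n => if n = 0 then (X 1 : MvPolynomial (Fin 2) (ZMod p)) else 0)) m 0
    rw [zero_add] at this
    rw [this, WittVector.add_coeff_zero]
    simp
  · exact WittVector.iterate_verschiebung_coeff_eq_zero _ (by omega)

lemma wittAlpha_last (p : ℕ) [Fact p.Prime] (N i j : ℕ) (l : Fin (N + 1) → ℕ) :
    wittAlpha p (N + 1) (Pi.single (Fin.last N) i) (Pi.single (Fin.last N) j) l =
      if l = Pi.single (Fin.last N) (i + j) then ((i + j).choose i : ZMod p) else 0 := by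
  have hf : Function.Injective fun a : Fin 2 => (a, N) := fun a b h => (Prod.mk.inj h).1
  have hexp : xyExp (N + 1) (Pi.single (Fin.last N) i) (Pi.single (Fin.last N) j) =
      (Finsupp.single (0 : Fin 2) i + Finsupp.single 1 j).mapDomain fun a : Fin 2 => (a, N) := by
    rw [xyExp, Fin.sum_univ_castSucc, Finset.sum_eq_zero]
    · simp [Finsupp.mapDomain_add]
    · intro m _
      simp
  have hcoeff : ∀ n, coeff (Finsupp.single (0 : Fin 2) i + Finsupp.single 1 j)
      ((X 0 + X 1 : MvPolynomial (Fin 2) (ZMod p)) ^ n) =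
        if n = i + j then ((i + j).choose i : ZMod p) else 0 := by
    intro n
    have hterm : ∀ k m : ℕ, coeff (Finsupp.single (0 : Fin 2) i + Finsupp.single 1 j)
        ((X 0 ^ k * X 1 ^ m * (n.choose k : MvPolynomial (Fin 2) (ZMod p)))) =
          if k = i ∧ m = j then (n.choose k : ZMod p) else 0 := by
      intro k m
      rw [X_pow_eq_monomial, X_pow_eq_monomial, monomial_mul, ← map_natCast C, mul_comm,
        C_mul_monomial, coeff_monomial]
      have : (Finsupp.single (0 : Fin 2) k + Finsupp.single 1 m =
          Finsupp.single (0 : Fin 2) i + Finsupp.single 1 j) ↔ k = i ∧ m = j := by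
        simp [Finsupp.ext_iff, Fin.forall_fin_two]
      simp [this]
    rw [add_pow, coeff_sum]
    simp only [hterm]
    split_ifs with h
    · subst h
      rw [Finset.sum_eq_single i]
      · simp
      · intro b _ hb
        simp [hb]
      · simp
    · refine Finset.sum_eq_zero fun k hk => if_neg ?_
      rintro ⟨rfl, hj⟩
      have := Finset.mem_range.1 hk
      omega
  rw [wittAlpha, hexp, ← coeff_killCompl hf, map_prod, Fin.prod_univ_castSucc]
  simp only [map_pow, Fin.val_castSucc, Fin.val_last, killCompl_wittHmod p N N le_rfl hf, if_true]
  have hprod : ∏ m : Fin N, killCompl hf (wittHmod p (m : ℕ)) ^ l m.castSucc =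
      if ∀ m : Fin N, l m.castSucc = 0 then 1 else 0 := by
    split_ifs with h
    · simp [h]
    · push Not at h
      obtain ⟨m, hm⟩ := h
      refine Finset.prod_eq_zero (Finset.mem_univ m) ?_
      rw [killCompl_wittHmod p N m m.2.le hf, if_neg m.2.ne, zero_pow hm]
  have hl : l = Pi.single (Fin.last N) (i + j) ↔
      (∀ m : Fin N, l m.castSucc = 0) ∧ l (Fin.last N) = i + j := by
    rw [funext_iff, Fin.forall_fin_succ']
    simp
  rw [hprod]
  by_cases h : ∀ m : Fin N, l m.castSucc = 0
  · simp [h, hl, hcoeff]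
  · simp only [zero_mul, coeff_zero, hl, h, false_and, if_false]

end WittCoefficients

section NilpotentEndomorphism

open Module

lemma rank_ker_pow_le {F V : Type*} [Field F] [AddCommGroup V] [Module F V]
    (T : End F V) (hT : Module.rank F (LinearMap.ker T) ≤ 1) (n : ℕ) :
    Module.rank F (LinearMap.ker (T ^ n)) ≤ n := by
  induction n with
  | zero => simp [Module.End.one_eq_id]
  | succ n ih =>
    let S : LinearMap.ker (T ^ (n + 1)) →ₗ[F] V := T ∘ₗ (LinearMap.ker (T ^ (n + 1))).subtype
    have h1 : LinearMap.range S ≤ LinearMap.ker (T ^ n) := by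
      rintro _ ⟨⟨x, hx⟩, rfl⟩
      rw [LinearMap.mem_ker, pow_succ] at hx
      exact hx
    have h2 : Module.rank F (LinearMap.ker S) ≤ 1 := by
      refine le_trans ?_ hT
      refine LinearMap.rank_le_of_injective
        ((((LinearMap.ker (T ^ (n + 1))).subtype ∘ₗ (LinearMap.ker S).subtype)).codRestrict
          (LinearMap.ker T) fun x => x.2) ?_
      intro x y hxy
      exact Subtype.ext (Subtype.ext (congrArg (LinearMap.ker T).subtype hxy))
    rw [← LinearMap.rank_range_add_rank_ker S]
    push_cast
    exact add_le_add ((Submodule.rank_mono h1).trans ih) h2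

/-- A nilpotent endomorphism with one-dimensional kernel has a single Jordan block, so the
dimension of the space is the nilpotency index. -/
lemma finrank_eq_iff_pow_ne_zero {F V : Type*} [Field F] [AddCommGroup V] [Module F V]
    (T : End F V) (hT : Module.rank F (LinearMap.ker T) ≤ 1) {n : ℕ} (hn : 1 ≤ n)
    (hTn : T ^ n = 0) : finrank F V = n ↔ T ^ (n - 1) ≠ 0 := by
  have hle : ∀ k : ℕ, T ^ k = 0 → Module.rank F V ≤ k := by
    intro k hk
    have := rank_ker_pow_le T hT k
    rwa [hk, LinearMap.ker_zero, rank_top] at this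
  have hfin : Module.Finite F V :=
    rank_lt_aleph0_iff.1 ((hle n hTn).trans_lt (Cardinal.natCast_lt_aleph0))
  have hle' : ∀ k : ℕ, T ^ k = 0 → finrank F V ≤ k := fun k hk =>
    finrank_le_of_rank_le (hle k hk)
  have hzero : T ^ finrank F V = 0 := by
    have h := LinearMap.aeval_self_charpoly T
    rwa [IsNilpotent.charpoly_eq_X_pow_finrank ⟨n, hTn⟩, map_pow,
      Polynomial.aeval_X] at h
  constructor
  · intro h h0
    have := hle' _ h0
    omega
  · intro h
    refine le_antisymm (hle' n hTn) ?_
    by_contra! hlt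
    exact h (pow_eq_zero_of_le (by omega) hzero)

end NilpotentEndomorphism

section HasseSchmidt

open scoped TensorProduct

lemma sum_pow_char_pow_of_commute {R ι : Type*} [Semiring R] (p m : ℕ) [Fact p.Prime] [CharP R p]
    (s : Finset ι) (f : ι → R) (hf : ∀ i j, Commute (f i) (f j)) :
    (∑ i ∈ s, f i) ^ p ^ m = ∑ i ∈ s, f i ^ p ^ m := by
  classical
  induction s using Finset.induction_on with
  | empty => simp [(Fact.out : p.Prime).ne_zero]
  | insert a s ha ih =>
    rw [Finset.sum_insert ha, Finset.sum_insert ha, add_pow_char_pow_of_commute, ih]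
    exact Commute.sum_right _ _ _ fun j _ => hf a j

/-- In characteristic `p`, the `p ^ m`-th iterates of the members of a commutative Hasse–Schmidt
derivation form again a Hasse–Schmidt derivation. -/
lemma leibniz_iterate {K : Type*} [Field K] (p : ℕ) [Fact p.Prime] [CharP K p] (d : ℕ → K → K)
    (hadd : ∀ n x y, d n (x + y) = d n x + d n y)
    (hmul : ∀ n x y, d n (x * y) = ∑ k ∈ Finset.range (n + 1), d k x * d (n - k) y)
    (hcomm : ∀ i j x, d i (d j x) = d j (d i x)) (m n : ℕ) (x y : K) :
    (d n)^[p ^ m] (x * y) =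
      ∑ k ∈ Finset.range (n + 1), (d k)^[p ^ m] x * (d (n - k))^[p ^ m] y := by
  let := ZMod.algebra K p
  let L : ℕ → Module.End (ZMod p) K := fun k =>
    AddMonoidHom.toZModLinearMap p (AddMonoidHom.mk' (d k) (hadd k))
  have hLd : ∀ k N z, (L k ^ N) z = (d k)^[N] z := fun k N z => by
    rw [Module.End.pow_apply]; rfl
  have hLcomm : ∀ i j, Commute (L i) (L j) := fun i j => LinearMap.ext fun z => hcomm i j z
  let μ := LinearMap.mul' (ZMod p) K
  let S : Module.End (ZMod p) (K ⊗[ZMod p] K) :=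
    ∑ k ∈ Finset.range (n + 1), TensorProduct.map (L k) (L (n - k))
  have h1 : L n ∘ₗ μ = μ ∘ₗ S := by
    refine TensorProduct.ext' fun a b => ?_
    simp only [LinearMap.comp_apply, S, LinearMap.sum_apply, TensorProduct.map_tmul, map_sum, μ,
      LinearMap.mul'_apply]
    exact hmul n a b
  have h2 : ∀ N, (L n ^ N) ∘ₗ μ = μ ∘ₗ (S ^ N) := by
    intro N
    induction N with
    | zero => simp [Module.End.one_eq_id]
    | succ N ih =>
      rw [pow_succ, pow_succ', Module.End.mul_eq_comp, Module.End.mul_eq_comp,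
        LinearMap.comp_assoc, h1, ← LinearMap.comp_assoc, ih, LinearMap.comp_assoc,
        ← Module.End.mul_eq_comp, ← pow_succ, pow_succ', Module.End.mul_eq_comp]
  have : CharP (Module.End (ZMod p) (K ⊗[ZMod p] K)) p :=
    charP_of_injective_algebraMap (algebraMap (ZMod p) _).injective p
  have h3 : S ^ p ^ m =
      ∑ k ∈ Finset.range (n + 1), TensorProduct.map (L k ^ p ^ m) (L (n - k) ^ p ^ m) := by
    simp only [S]
    rw [sum_pow_char_pow_of_commute]
    · simp only [TensorProduct.map_pow]
    · intro i j
      rw [Commute, SemiconjBy, ← TensorProduct.map_mul, ← TensorProduct.map_mul,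
        (hLcomm _ _).eq, (hLcomm (n - i) _).eq]
  have h4 := LinearMap.congr_fun (h2 (p ^ m)) (x ⊗ₜ y)
  rw [h3] at h4
  simpa only [LinearMap.comp_apply, LinearMap.sum_apply, TensorProduct.map_tmul, map_sum, μ,
    LinearMap.mul'_apply, hLd] using h4

lemma foldr_comp_add {K : Type*} [Add K] (l : List (K → K))
    (hl : ∀ f ∈ l, ∀ x y, f (x + y) = f x + f y) (x y : K) :
    l.foldr (· ∘ ·) id (x + y) = l.foldr (· ∘ ·) id x + l.foldr (· ∘ ·) id y := by
  induction l with
  | nil => rfl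
  | cons f l ih =>
    simp only [List.foldr_cons, Function.comp_apply]
    rw [ih fun g hg => hl g (List.mem_cons_of_mem _ hg), hl f List.mem_cons_self]

lemma foldr_comp_leibniz {K : Type*} [CommRing K] (e : ℕ) (G : Fin e → ℕ → K → K)
    (hadd : ∀ m n x y, G m n (x + y) = G m n x + G m n y)
    (hmul : ∀ m n x y, G m n (x * y) = ∑ k ∈ Finset.range (n + 1), G m k x * G m (n - k) y)
    (v : Fin e → ℕ) (x y : K) :
    (List.ofFn fun m => G m (v m)).foldr (· ∘ ·) id (x * y) =
      ∑ k ∈ Finset.Iic v, (List.ofFn fun m => G m (k m)).foldr (· ∘ ·) id x *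
        (List.ofFn fun m => G m ((v - k) m)).foldr (· ∘ ·) id y := by
  induction e with
  | zero =>
    have : Finset.Iic v = {v} := by ext k; simp [Subsingleton.elim k v]
    simp [this]
  | succ e ih =>
    have hsum : ∀ n (s : Finset (Fin e → ℕ)) (f : (Fin e → ℕ) → K),
        G 0 n (∑ k ∈ s, f k) = ∑ k ∈ s, G 0 n (f k) := fun n s f =>
      map_sum (AddMonoidHom.mk' (G 0 n) (hadd 0 n)) f s
    simp only [List.ofFn_succ, List.foldr_cons, Function.comp_apply, Pi.sub_apply]
    rw [ih (fun m => G m.succ) (fun m => hadd m.succ) (fun m => hmul m.succ) (fun m => v m.succ),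
      hsum]
    simp only [hmul]
    rw [Finset.sum_comm, ← Finset.sum_product']
    refine Finset.sum_nbij' (fun q => Fin.cons q.1 q.2) (fun k => (k 0, Fin.tail k)) ?_ ?_ ?_ ?_ ?_
    · rintro ⟨a, k⟩ h
      simp only [Finset.mem_product, Finset.mem_range, Finset.mem_Iic] at h
      rw [Finset.mem_Iic, Pi.le_def, Fin.forall_fin_succ]
      exact ⟨Nat.lt_succ_iff.1 h.1, h.2⟩
    · intro k h
      rw [Finset.mem_Iic, Pi.le_def, Fin.forall_fin_succ] at h
      simp only [Finset.mem_product, Finset.mem_range, Finset.mem_Iic]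
      exact ⟨Nat.lt_succ_iff.2 h.1, h.2⟩
    · rintro ⟨a, k⟩ _
      simp
    · intro k _
      simp
    · rintro ⟨a, k⟩ _
      simp

lemma foldr_comp_eq_of_ne {K : Type*} (e : ℕ) (f : Fin e → K → K) (m : Fin e)
    (hf : ∀ j, j ≠ m → f j = id) : (List.ofFn f).foldr (· ∘ ·) id = f m := by
  induction e with
  | zero => exact m.elim0
  | succ e ih =>
    rw [List.ofFn_succ, List.foldr_cons]
    induction m using Fin.cases with
    | zero =>
      have : (List.ofFn fun i : Fin e => f i.succ) = List.replicate e id := by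
        rw [← List.ofFn_const]
        exact congrArg _ (funext fun i => hf _ (Fin.succ_ne_zero i))
      rw [this]
      have hrep : ∀ k, (List.replicate k (id : K → K)).foldr (· ∘ ·) id = id := by
        intro k
        induction k with
        | zero => rfl
        | succ k ih => rw [List.replicate_succ, List.foldr_cons, ih]; rfl
      rw [hrep, Function.comp_id]
    | succ m =>
      rw [ih (fun i => f i.succ) m fun j hj => hf _ (by simpa using hj),
        hf 0 (Fin.succ_ne_zero m).symm, Function.id_comp]

lemma hsComp_single {K : Type*} (p e : ℕ) (d : ℕ → K → K) (hd : d 0 = id) (m : Fin e) (n : ℕ) :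
    hsComp p e d (Pi.single m n) = (d n)^[p ^ (m : ℕ)] := by
  rw [hsComp, foldr_comp_eq_of_ne e _ m, Pi.single_eq_same]
  intro j hj
  rw [Pi.single_eq_of_ne hj, hd, Function.iterate_id]

lemma iterate_add_of_add {K : Type*} [Add K] (f : K → K) (hf : ∀ x y, f (x + y) = f x + f y)
    (n : ℕ) (x y : K) : f^[n] (x + y) = f^[n] x + f^[n] y := by
  induction n generalizing x y with
  | zero => rfl
  | succ n ih => rw [Function.iterate_succ_apply, hf, ih]; rfl

lemma iterate_eq_zero_of_divided_powers {K : Type*} [Field K] (p : ℕ) [Fact p.Prime] [CharP K p]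
    (E : ℕ → K → K) (hadd : ∀ n x y, E n (x + y) = E n x + E n y)
    (hE : ∀ i j x, E i (E j x) = ((i + j).choose i : K) * E (i + j) x)
    (n : ℕ) (hn : 1 ≤ n) (x : K) : (E n)^[p] x = 0 := by
  have hnat : ∀ (c : ℕ) z, E n (c * z) = c * E n z := fun c z => by
    rw [← nsmul_eq_mul, ← nsmul_eq_mul]
    exact map_nsmul (AddMonoidHom.mk' (E n) (hadd n)) c z
  have hstep : ∀ k, ∃ c : ℕ, (E n)^[k + 1] x = c * E ((k + 1) * n) x := by
    intro k
    induction k with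
    | zero => exact ⟨1, by simp⟩
    | succ k ih =>
      obtain ⟨c, hc⟩ := ih
      refine ⟨c * (n + (k + 1) * n).choose n, ?_⟩
      rw [Function.iterate_succ_apply', hc, hnat, hE, show n + (k + 1) * n = (k + 1 + 1) * n by ring]
      push_cast
      ring
  have hp := (Fact.out : p.Prime).two_le
  obtain ⟨k, rfl⟩ : ∃ k, p = k + 1 + 1 := ⟨p - 2, by omega⟩
  obtain ⟨n, rfl⟩ := Nat.exists_eq_add_of_le' hn
  obtain ⟨c, hc⟩ := hstep k
  have hchoose : (((n + 1 + (k + 1) * (n + 1)).choose (n + 1) : ℕ) : K) = 0 := by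
    rw [CharP.cast_eq_zero_iff K (k + 1 + 1)]
    refine ⟨(n + (k + 1) * (n + 1)).choose n, ?_⟩
    have h := Nat.add_one_mul_choose_eq (n + (k + 1) * (n + 1)) n
    have h' : n + (k + 1) * (n + 1) + 1 = n + 1 + (k + 1) * (n + 1) := by ring
    rw [h'] at h
    refine Nat.eq_of_mul_eq_mul_right (Nat.succ_pos n) (h.symm.trans ?_)
    rw [Nat.succ_eq_add_one]
    ring
  rw [Function.iterate_succ_apply', hc, hnat, hE, hchoose]
  ring

end HasseSchmidt

section Derivations

lemma map_pow_char_eq_zero {K : Type*} [Field K] (p : ℕ) [CharP K p] (d : K → K)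
    (hmul : ∀ x y, d (x * y) = x * d y + d x * y) (y : K) : d (y ^ p) = 0 := by
  have h1 : d 1 = 0 := by simpa using hmul 1 1
  have h : ∀ n : ℕ, d (y ^ (n + 1)) = (n + 1 : ℕ) * y ^ n * d y := by
    intro n
    induction n with
    | zero => simp
    | succ n ih =>
      rw [pow_succ, hmul, ih]
      push_cast
      ring
  cases p with
  | zero => simpa using h1
  | succ n => rw [h, CharP.cast_eq_zero]; ring

lemma finrank_frobenius_eq_iff {K : Type*} [Field K] (p n : ℕ) [Fact p.Prime] [CharP K p]
    (d : K → K) (hadd : ∀ x y, d (x + y) = d x + d y)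
    (hmul : ∀ x y, d (x * y) = x * d y + d x * y) (hn : 1 ≤ n) (hnil : ∀ x, d^[n] x = 0)
    (hker : ∀ x, d x = 0 → ∃ y, x = y ^ p) :
    Module.finrank ↥(RingHom.fieldRange (frobenius K p)) K = n ↔ ∃ x, d^[n - 1] x ≠ 0 := by
  let T : Module.End ↥(RingHom.fieldRange (frobenius K p)) K :=
    { toFun := d
      map_add' := hadd
      map_smul' := by
        rintro ⟨_, y, rfl⟩ x
        simp only [Subfield.smul_def, smul_eq_mul, RingHom.id_apply, frobenius_def]
        rw [hmul, map_pow_char_eq_zero p d hmul, zero_mul, add_zero] }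
  have hT : ∀ k x, (T ^ k) x = d^[k] x := fun k x => by rw [Module.End.pow_apply]; rfl
  have hrank : Module.rank ↥(RingHom.fieldRange (frobenius K p)) (LinearMap.ker T) ≤ 1 := by
    rw [rank_submodule_le_one_iff']
    refine ⟨1, fun x hx => ?_⟩
    obtain ⟨y, rfl⟩ := hker x hx
    exact Submodule.mem_span_singleton.2 ⟨⟨y ^ p, y, rfl⟩, by simp [Subfield.smul_def]⟩
  rw [finrank_eq_iff_pow_ne_zero T hrank hn (LinearMap.ext fun x => (hT n x).trans (hnil x)),
    Ne, LinearMap.ext_iff, not_forall]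
  simp only [hT, LinearMap.zero_apply]

end Derivations

/-- Let `K` be a field of characteristic `p` with a family `(D_𝐢)_{𝐢∈ℕ^e}`, `D_0 = id`,
satisfying the defining relations
`D_𝐢 = D_{i_1·𝐞_1} ∘ (D_{i_2·𝐞_1})^(p) ∘ … ∘ (D_{i_e·𝐞_1})^(p^{e−1})`, and write
`Dn n := D_{n·𝐞_1}`.  Then `(K, (D_𝐢))` is a model of `W_e`-DCF if and only if `K` is
separably closed and `(Dn n)_{n∈ℕ}` satisfies H1', H2', H3', H4', H5', H6' and H8'.
(This is the semantic content of the statement that `(SHF-bar_{p,e})*` equals `W_e`-DCF.) -/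
theorem isWeDCF_iff_SHF_axioms (p e : ℕ) [Fact p.Prime] (he : 1 ≤ e)
    (K : Type*) [Field K] [CharP K p] (D : (Fin e → ℕ) → K → K)
    (h0 : D 0 = id)
    (hdef : ∀ i : Fin e → ℕ,
      D i = hsComp p e (fun n => D (Pi.single (⟨0, he⟩ : Fin e) n)) i) :
    IsWeDCF p e K D ↔
      (IsSepClosed K ∧
       (∀ n : ℕ, ∀ x y : K,
          D (Pi.single (⟨0, he⟩ : Fin e) n) (x + y) =
            D (Pi.single (⟨0, he⟩ : Fin e) n) x + D (Pi.single (⟨0, he⟩ : Fin e) n) y) ∧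
       (∀ n : ℕ, ∀ x y : K,
          D (Pi.single (⟨0, he⟩ : Fin e) n) (x * y) =
            ∑ k ∈ Finset.range (n + 1),
              D (Pi.single (⟨0, he⟩ : Fin e) k) x *
                D (Pi.single (⟨0, he⟩ : Fin e) (n - k)) y) ∧
       (∀ i j : ℕ, ∀ x : K,
          D (Pi.single (⟨0, he⟩ : Fin e) i) (D (Pi.single (⟨0, he⟩ : Fin e) j) x) =
            D (Pi.single (⟨0, he⟩ : Fin e) j) (D (Pi.single (⟨0, he⟩ : Fin e) i) x)) ∧
       (∀ n : ℕ, 1 ≤ n → ∀ x : K,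
          (D (Pi.single (⟨0, he⟩ : Fin e) n))^[p ^ e] x = 0) ∧
       (∃ x : K, (D (Pi.single (⟨0, he⟩ : Fin e) 1))^[p ^ e - 1] x ≠ 0) ∧
       (∀ x : K, D (Pi.single (⟨0, he⟩ : Fin e) 1) x = 0 → ∃ y : K, x = y ^ p) ∧
       (∀ i j : Fin e → ℕ, ∀ x : K,
          hsComp p e (fun n => D (Pi.single (⟨0, he⟩ : Fin e) n)) i
              (hsComp p e (fun n => D (Pi.single (⟨0, he⟩ : Fin e) n)) j x) =
            ∑ᶠ l : Fin e → ℕ, ZMod.cast (wittAlpha p e i j l) *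
              hsComp p e (fun n => D (Pi.single (⟨0, he⟩ : Fin e) n)) l x)) := by
  have hp := (Fact.out : p.Prime)
  have hd0 : D (Pi.single (⟨0, he⟩ : Fin e) 0) = id := by rw [Pi.single_zero, h0]
  have hsingle : ∀ (m : Fin e) n,
      D (Pi.single m n) = (D (Pi.single (⟨0, he⟩ : Fin e) n))^[p ^ (m : ℕ)] := fun m n => by
    rw [hdef, hsComp_single p e _ hd0]
  simp only [← hdef]
  generalize hd : (fun n => D (Pi.single (⟨0, he⟩ : Fin e) n)) = d at hdef
  have hd' : ∀ n, D (Pi.single (⟨0, he⟩ : Fin e) n) = d n := fun n => congrFun hd n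
  simp only [hd'] at hd0 hsingle ⊢
  have hpe : 1 ≤ p ^ e := Nat.one_le_pow _ _ hp.pos
  have hleib : (∀ n x y, d n (x * y) = ∑ k ∈ Finset.range (n + 1), d k x * d (n - k) y) →
      ∀ x y, d 1 (x * y) = x * d 1 y + d 1 x * y := fun h x y => by
    rw [h, Finset.sum_range_succ, Finset.sum_range_one, hd0]; simp
  constructor
  · rintro ⟨hsep, hrank, -, hadd, hmul, hiter, hstrict⟩
    have hdadd : ∀ n x y, d n (x + y) = d n x + d n y := fun n => by
      rw [← hd']; exact hadd _
    have hdmul : ∀ n x y, d n (x * y) = ∑ k ∈ Finset.range (n + 1), d k x * d (n - k) y := by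
      intro n x y
      rw [← hd', hmul]
      symm
      refine Finset.sum_nbij' (fun k => Pi.single ⟨0, he⟩ k) (fun k => k ⟨0, he⟩) ?_ ?_ ?_ ?_ ?_
      · intro k hk
        rw [Finset.mem_Iic, Pi.single_le_single]
        exact Nat.lt_succ_iff.1 (Finset.mem_range.1 hk)
      · intro k hk
        have := Finset.mem_Iic.1 hk ⟨0, he⟩
        rw [Pi.single_eq_same] at this
        exact Finset.mem_range.2 (Nat.lt_succ_iff.2 this)
      · intro k _
        simp
      · intro k hk
        funext m
        by_cases hm : m = ⟨0, he⟩
        · subst hm; simp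
        · have := Finset.mem_Iic.1 hk m
          rw [Pi.single_eq_of_ne hm] at this ⊢
          exact (Nat.le_zero.1 this).symm
      · intro k _
        have hsub : (Pi.single ⟨0, he⟩ n - Pi.single ⟨0, he⟩ k : Fin e → ℕ) =
            Pi.single ⟨0, he⟩ (n - k) := by
          funext m
          by_cases hm : m = ⟨0, he⟩
          · subst hm; simp
          · simp [hm]
        rw [hsub, hd', hd']
    have hdcomm : ∀ i j x, d i (d j x) = d j (d i x) := by
      intro i j x
      rw [← hd', ← hd', hiter, hiter]
      simp only [wittAlpha_comm p e (Pi.single _ i)]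
    have hnil : ∀ n, 1 ≤ n → ∀ x, (d n)^[p ^ e] x = 0 := by
      intro n hn x
      obtain ⟨N, rfl⟩ := Nat.exists_eq_add_of_le' he
      rw [pow_succ, Function.iterate_mul]
      have hlast : ∀ n, D (Pi.single (Fin.last N) n) = (d n)^[p ^ N] := fun n => hsingle _ n
      refine iterate_eq_zero_of_divided_powers p (fun n => (d n)^[p ^ N])
        (fun n => ?_) (fun i j x => ?_) n hn x
      · simp only [← hlast]
        exact hadd _
      · simp only [← hlast]
        rw [hiter, finsum_eq_single _ (Pi.single (Fin.last N) (i + j))]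
        · rw [wittAlpha_last, if_pos rfl, ZMod.cast_natCast']
        · intro l hl
          rw [wittAlpha_last, if_neg hl, ZMod.cast_zero, zero_mul]
    have hker : ∀ x, d 1 x = 0 → ∃ y, x = y ^ p := by
      intro x hx
      have hz : d 1 0 = 0 := by simpa using hdadd 1 0 0
      refine (hstrict x).1 fun m => ?_
      rw [hsingle, ← Nat.sub_add_cancel (Nat.one_le_pow m p hp.pos), Function.iterate_succ_apply,
        hx]
      exact Function.iterate_fixed hz _
    exact ⟨hsep, hdadd, hdmul, hdcomm, hnil,
      (finrank_frobenius_eq_iff p (p ^ e) (d 1) (hdadd 1) (hleib hdmul) hpe (hnil 1 le_rfl)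
        hker).1 hrank, hker, hiter⟩
  · rintro ⟨hsep, hdadd, hdmul, hdcomm, hnil, hne, hker, hiter⟩
    refine ⟨hsep, (finrank_frobenius_eq_iff p (p ^ e) (d 1) (hdadd 1) (hleib hdmul) hpe
      (hnil 1 le_rfl) hker).2 hne, h0, fun i x y => ?_, fun i x y => ?_, hiter, fun x => ?_⟩
    · rw [hdef]
      refine foldr_comp_add _ (fun f hf => ?_) x y
      obtain ⟨m, rfl⟩ := List.mem_ofFn.1 hf
      exact iterate_add_of_add _ (hdadd _) _
    · simp only [hdef]
      exact foldr_comp_leibniz e (fun m n => (d n)^[p ^ (m : ℕ)])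
        (fun m n => iterate_add_of_add _ (hdadd n) _)
        (fun m n => leibniz_iterate p d hdadd hdmul hdcomm m n) i x y
    · constructor
      · intro h
        refine hker x ?_
        have := h ⟨0, he⟩
        rwa [hd'] at this
      · rintro ⟨y, rfl⟩ m
        have hz : d 1 0 = 0 := by simpa using hdadd 1 0 0
        rw [hsingle, ← Nat.sub_add_cancel (Nat.one_le_pow m p hp.pos),
          Function.iterate_succ_apply, map_pow_char_eq_zero p (d 1) (hleib hdmul)]
        exact Function.iterate_fixed hz _
end
end

section
/- Let K be a separably closed field of characteristic p with [K : K^p] = p^e and let b_1,…,b_e ∈ K be a p-basis of K, i.e. the monomials b̄^𝐢 = b_1^{i_1}···b_e^{i_e} for 𝐢 ∈ [p]^e are linearly independent over K^p (equivalently, for every n ≥ 1 each x ∈ K has a unique representation x = Σ_{𝐢∈[p^n]^e} α_𝐢^{p^n}·b̄^𝐢 with α_𝐢 ∈ K). For 𝐣 ∈ ℕ^e and any n ≥ max(j_1,…,j_e), define D_𝐣 : K → K by D_𝐣(Σ_{𝐢∈[p^n]^e} α_𝐢^{p^n}·b̄^𝐢) := Σ_{𝐢∈[p^n]^e} α_𝐢^{p^n}·δ_𝐣^𝐢(b̄).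 Then each D_𝐣 is well defined (independent of the choice of n ≥ max(j_1,…,j_e)), the family (D_𝐣)_{𝐣∈ℕ^e} is a strict W_e-iterative Hasse–Schmidt derivation of dimension e on K — so that (K, (D_𝐣)) is a model of W_e-DCF — and D_𝐣(b̄^𝐢) = δ_𝐣^𝐢(b̄) for all 𝐢, 𝐣 ∈ ℕ^e. -/
noncomputable section

open scoped BigOperators

/-- The exponent of the monomial `Ȳ^j` in the `Y`-variables (indexed by `ℕ`). -/
def yExp (e : ℕ) (j : Fin e → ℕ) : ℕ →₀ ℕ :=
  ∑ m : Fin e, Finsupp.single (m : ℕ) (j m)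

/-- `wittDelta p e b i j` is `δ_𝐣^𝐢(b̄) ∈ K`: the polynomial `δ_𝐣^𝐢(X̄) ∈ 𝔽_p[X̄]`, i.e. the
coefficient of `Ȳ^𝐣` in `H_1^{i_1} ⋯ H_e^{i_e}` regarded as a polynomial in `Ȳ` over `𝔽_p[X̄]`,
evaluated at `X̄ := b̄`.  (Equivalently, the value `d_𝐣(b̄^𝐢)` of the canonical `W_e`-derivation.)
Concretely, we substitute `b` for the `X`-variables `(0, m)` — keeping the `Y`-variables
`(1, m)` — in `H_1^{i_1} ⋯ H_e^{i_e}` and take the coefficient of `Ȳ^𝐣`. -/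
def wittDelta (p e : ℕ) [Fact p.Prime] {K : Type*} [Field K] [CharP K p]
    (b : Fin e → K) (i j : Fin e → ℕ) : K :=
  MvPolynomial.coeff (yExp e j)
    (MvPolynomial.eval₂
      ((MvPolynomial.C : K →+* MvPolynomial ℕ K).comp (ZMod.castHom (dvd_refl p) K))
      (fun v : Fin 2 × ℕ =>
        if h : v.2 < e then
          (if v.1 = 0 then MvPolynomial.C (b ⟨v.2, h⟩) else MvPolynomial.X v.2)
        else 0)
      (∏ m : Fin e, (wittHmod p (m : ℕ)) ^ (i m)))

namespace WittHS

/-- Every element of `K` is uniquely a `K^p`-combination of the monomials in `b` of exponents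
less than `p`. -/
def IsPBasis (p : ℕ) {e : ℕ} {K : Type*} [Field K] (b : Fin e → K) : Prop :=
  ∀ x : K, ∃! a : (Fin e → Fin p) → K, x = ∑ i, a i ^ p * ∏ m, b m ^ (i m : ℕ)

section PBasis

variable {p e : ℕ} [Fact p.Prime] {K : Type*} [Field K] [CharP K p] {b : Fin e → K}

theorem IsPBasis.of_linearIndependent
    (hdeg : Module.finrank ↥(RingHom.fieldRange (frobenius K p)) K = p ^ e)
    (hb : LinearIndependent ↥(RingHom.fieldRange (frobenius K p))
      (fun i : Fin e → Fin p => ∏ m : Fin e, b m ^ ((i m : ℕ)))) : IsPBasis p b := by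
  have : Nonempty (Fin e → Fin p) := ⟨fun _ => ⟨0, (Fact.out : p.Prime).pos⟩⟩
  let B := basisOfLinearIndependentOfCardEqFinrank hb (by simp [hdeg])
  have hB : ∀ i, B i = ∏ m : Fin e, b m ^ ((i m : ℕ)) := fun i => by simp [B]
  have hroot : ∀ y : RingHom.fieldRange (frobenius K p), ∃ a : K, a ^ p = y := fun y => by
    obtain ⟨a, ha⟩ := y.2
    exact ⟨a, ha⟩
  choose r hr using hroot
  intro x
  refine ⟨fun i => r (B.repr x i), ?_, fun a ha => ?_⟩
  · simp only [hr]
    conv_lhs => rw [← B.sum_repr x]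
    simp [hB, Subfield.smul_def]
  · have hx : x = ∑ i, (⟨a i ^ p, ⟨a i, rfl⟩⟩ : RingHom.fieldRange (frobenius K p)) • B i := by
      rw [ha]
      simp [hB, Subfield.smul_def]
    funext i
    apply frobenius_inj K p
    simp only [frobenius_def, hr]
    rw [hx, B.repr_sum_self]

namespace IsPBasis

/-- The `p`-th roots of the coordinates with respect to a `p`-basis. -/
def coord (hb : IsPBasis p b) (x : K) : (Fin e → Fin p) → K := (hb x).choose

omit [Fact p.Prime] [CharP K p] in
theorem sum_coord (hb : IsPBasis p b) (x : K) :
    ∑ i, hb.coord x i ^ p * ∏ m, b m ^ (i m : ℕ) = x :=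
  (hb x).choose_spec.1.symm

omit [Fact p.Prime] [CharP K p] in
theorem coord_eq (hb : IsPBasis p b) {x : K} {a : (Fin e → Fin p) → K}
    (h : ∑ i, a i ^ p * ∏ m, b m ^ (i m : ℕ) = x) : hb.coord x = a :=
  ((hb x).choose_spec.2 a h.symm).symm

theorem coord_add (hb : IsPBasis p b) (x y : K) :
    hb.coord (x + y) = hb.coord x + hb.coord y := by
  apply hb.coord_eq
  simp only [Pi.add_apply, add_pow_char, add_mul, Finset.sum_add_distrib, hb.sum_coord]

omit [Fact p.Prime] [CharP K p] in
theorem coord_pow_mul (hb : IsPBasis p b) (a x : K) (i : Fin e → Fin p) :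
    hb.coord (a ^ p * x) i = a * hb.coord x i := by
  have : hb.coord (a ^ p * x) = fun i => a * hb.coord x i := by
    apply hb.coord_eq
    simp only [mul_pow, mul_assoc, ← Finset.mul_sum, hb.sum_coord]
  rw [this]

omit [CharP K p] in
theorem coord_monomial (hb : IsPBasis p b) (k : Fin e → Fin p) :
    hb.coord (∏ m, b m ^ (k m : ℕ)) = Pi.single k 1 := by
  apply hb.coord_eq
  rw [Finset.sum_eq_single k]
  · simp
  · intro i _ hi
    simp [hi, (Fact.out : p.Prime).ne_zero]
  · simp

section Lift

variable {R : Type*} [CommRing R] (ψ : K →+* R) (h : Fin e → R)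

/-- The additive map sending `a ^ p * b ^ i` to `ψ a * h ^ i`. -/
def liftAdd (hb : IsPBasis p b) : K →+ R where
  toFun x := ∑ i, ψ (hb.coord x i) * ∏ m, h m ^ (i m : ℕ)
  map_zero' := by
    have : hb.coord 0 = 0 := by
      have := hb.coord_add 0 0
      simpa using this
    simp [this]
  map_add' x y := by
    simp [hb.coord_add, add_mul, Finset.sum_add_distrib]

theorem liftAdd_apply (hb : IsPBasis p b) (x : K) :
    hb.liftAdd ψ h x = ∑ i, ψ (hb.coord x i) * ∏ m, h m ^ (i m : ℕ) := rfl

theorem liftAdd_pow_mul (hb : IsPBasis p b) (a x : K) :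
    hb.liftAdd ψ h (a ^ p * x) = ψ a * hb.liftAdd ψ h x := by
  simp [liftAdd_apply, coord_pow_mul, Finset.mul_sum, mul_assoc]

theorem liftAdd_monomial (hb : IsPBasis p b) (hh : ∀ m, h m ^ p = ψ (b m)) (k : Fin e → ℕ) :
    hb.liftAdd ψ h (∏ m, b m ^ k m) = ∏ m, h m ^ k m := by
  have hp : 0 < p := (Fact.out : p.Prime).pos
  have split : ∀ {S : Type _} [CommRing S] (c : Fin e → S),
      ∏ m, c m ^ k m = (∏ m, c m ^ (k m / p)) ^ p * ∏ m, c m ^ (k m % p) := by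
    intro S _ c
    rw [← Finset.prod_pow, ← Finset.prod_mul_distrib]
    refine Finset.prod_congr rfl fun m _ => ?_
    rw [← pow_mul, ← pow_add, mul_comm, Nat.div_add_mod]
  have split' : ∏ m, h m ^ k m = (∏ m, h m ^ (k m / p)) ^ p * ∏ m, h m ^ (k m % p) := by
    rw [← Finset.prod_pow, ← Finset.prod_mul_distrib]
    refine Finset.prod_congr rfl fun m _ => ?_
    rw [← pow_mul, ← pow_add, mul_comm, Nat.div_add_mod]
  rw [split b, liftAdd_pow_mul, split', map_prod]
  congr 1
  · rw [← Finset.prod_pow]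
    refine Finset.prod_congr rfl fun m _ => ?_
    rw [map_pow, ← hh, ← pow_mul, ← pow_mul, mul_comm]
  · have := hb.coord_monomial (fun m => ⟨k m % p, Nat.mod_lt _ hp⟩)
    simp only at this
    rw [liftAdd_apply, this, Finset.sum_eq_single (fun m => ⟨k m % p, Nat.mod_lt _ hp⟩)]
    · simp
    · intro i _ hi
      simp [hi]
    · simp

/-- The ring homomorphism sending `a ^ p` to `ψ a` and `b m` to `h m`. -/
def lift (hb : IsPBasis p b) (hh : ∀ m, h m ^ p = ψ (b m)) : K →+* R :=
  { hb.liftAdd ψ h with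
    map_one' := by
      have := hb.liftAdd_monomial ψ h hh 0
      simpa using this
    map_mul' := fun x y => by
      change hb.liftAdd ψ h (x * y) = hb.liftAdd ψ h x * hb.liftAdd ψ h y
      conv_lhs => rw [← hb.sum_coord x, ← hb.sum_coord y]
      rw [Finset.sum_mul_sum, map_sum, liftAdd_apply, liftAdd_apply, Finset.sum_mul_sum]
      refine Finset.sum_congr rfl fun i _ => ?_
      rw [map_sum]
      refine Finset.sum_congr rfl fun j _ => ?_
      have : hb.coord x i ^ p * (∏ m, b m ^ (i m : ℕ)) *
          (hb.coord y j ^ p * ∏ m, b m ^ (j m : ℕ)) =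
          (hb.coord x i * hb.coord y j) ^ p * ∏ m, b m ^ ((i m : ℕ) + (j m : ℕ)) := by
        simp only [pow_add, Finset.prod_mul_distrib]
        ring
      rw [this, liftAdd_pow_mul, liftAdd_monomial _ _ _ hh, map_mul]
      simp only [pow_add, Finset.prod_mul_distrib]
      ring }

theorem lift_pow (hb : IsPBasis p b) (hh : ∀ m, h m ^ p = ψ (b m)) (a : K) :
    hb.lift ψ h hh (a ^ p) = ψ a := by
  change hb.liftAdd ψ h (a ^ p) = ψ a
  have := hb.liftAdd_pow_mul ψ h a 1
  have h1 : hb.liftAdd ψ h 1 = 1 := (hb.lift ψ h hh).map_one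
  simpa [h1] using this

theorem lift_basis (hb : IsPBasis p b) (hh : ∀ m, h m ^ p = ψ (b m)) (m : Fin e) :
    hb.lift ψ h hh (b m) = h m := by
  change hb.liftAdd ψ h (b m) = h m
  have := hb.liftAdd_monomial ψ h hh (Pi.single m 1)
  simpa [Pi.single_apply, pow_ite] using this

end Lift

omit [Fact p.Prime] [CharP K p] in
/-- Two ring homomorphisms that agree on a `p`-basis and are congruent modulo the first ideal of a
chain along which `p`-th powers improve congruences are congruent modulo the whole chain. -/
theorem sub_mem (hb : IsPBasis p b) {R : Type*} [CommRing R] (J : ℕ → Ideal R)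
    (hJ : ∀ n u v, u - v ∈ J n → u ^ p - v ^ p ∈ J (n + 1)) {f g : K →+* R}
    (hfg : ∀ m, f (b m) = g (b m)) (h0 : ∀ x, f x - g x ∈ J 0) (n : ℕ) (x : K) :
    f x - g x ∈ J n := by
  induction n generalizing x with
  | zero => exact h0 x
  | succ n ih =>
    rw [← hb.sum_coord x]
    simp only [map_sum, map_mul, map_pow, map_prod, hfg, ← Finset.sum_sub_distrib, ← sub_mul]
    exact Ideal.sum_mem _ fun i _ => Ideal.mul_mem_right _ _ (hJ n _ _ (ih _))

end IsPBasis

end PBasis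

section BoxIdeal

open MvPowerSeries

variable (p : ℕ) (σ K : Type*) [Field K]

/-- The ideal of power series without monomials all of whose exponents are less than `p ^ n`. -/
def boxIdeal (n : ℕ) : Ideal (MvPowerSeries σ K) where
  carrier := {f | ∀ d : σ →₀ ℕ, (∀ s, d s < p ^ n) → coeff d f = 0}
  zero_mem' := by simp
  add_mem' := fun hf hg d hd => by simp [hf d hd, hg d hd]
  smul_mem' := fun c f hf d hd => by
    classical
    rw [smul_eq_mul, coeff_mul]
    refine Finset.sum_eq_zero fun x hx => ?_
    rw [hf, mul_zero]
    intro s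
    rw [Finset.HasAntidiagonal.mem_antidiagonal] at hx
    refine lt_of_le_of_lt ?_ (hd s)
    rw [← hx]
    simp

variable {p σ K}

theorem mem_boxIdeal {n : ℕ} {f : MvPowerSeries σ K} :
    f ∈ boxIdeal p σ K n ↔ ∀ d : σ →₀ ℕ, (∀ s, d s < p ^ n) → coeff d f = 0 := Iff.rfl

theorem mem_boxIdeal_zero {f : MvPowerSeries σ K} :
    f ∈ boxIdeal p σ K 0 ↔ constantCoeff f = 0 := by
  rw [mem_boxIdeal]
  refine ⟨fun h => h 0 (by simp), fun h d hd => ?_⟩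
  have : d = 0 := by
    ext s
    simpa using hd s
  rw [this]
  exact h

theorem boxIdeal_le [Fact p.Prime] {m n : ℕ} (h : m ≤ n) :
    boxIdeal p σ K n ≤ boxIdeal p σ K m := fun _ hf d hd =>
  hf d fun s => (hd s).trans_le (Nat.pow_le_pow_right (Fact.out : p.Prime).pos h)

theorem lt_pow_degree [Fact p.Prime] (d : σ →₀ ℕ) (s : σ) : d s < p ^ d.degree :=
  (Finsupp.le_degree s d).trans_lt (Nat.lt_pow_self (Fact.out : p.Prime).one_lt)

theorem eq_of_sub_mem_boxIdeal [Fact p.Prime] {f g : MvPowerSeries σ K}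
    (h : ∀ n, f - g ∈ boxIdeal p σ K n) : f = g := by
  ext d
  have := h d.degree d (lt_pow_degree d)
  rwa [map_sub, sub_eq_zero] at this

theorem pow_sub_pow_mem_boxIdeal [Fact p.Prime] [CharP K p] [Finite σ] (n : ℕ)
    (u v : MvPowerSeries σ K)
    (h : u - v ∈ boxIdeal p σ K n) : u ^ p - v ^ p ∈ boxIdeal p σ K (n + 1) := by
  have hp := (Fact.out : p.Prime)
  have : CharP (MvPowerSeries σ K) p :=
    charP_of_injective_ringHom (C_injective (σ := σ) (R := K)) p
  rw [← sub_pow_char]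
  intro d hd
  rw [← map_frobenius_expand p hp.ne_zero, coeff_map]
  by_cases hdvd : ∀ s, p ∣ d s
  · choose k hk using hdvd
    have : d = p • Finsupp.equivFunOnFinite.symm k := by
      ext s
      simp [hk s]
    rw [this, coeff_expand_smul, h, map_zero]
    intro s
    have := hd s
    rw [hk s, pow_succ'] at this
    exact lt_of_mul_lt_mul_left this (Nat.zero_le _)
  · push Not at hdvd
    obtain ⟨s, hs⟩ := hdvd
    rw [coeff_expand_of_not_dvd _ _ _ hs, map_zero]

end BoxIdeal

section WittAddition

variable {p : ℕ} [Fact p.Prime] {e : ℕ} {R S : Type*} [CommRing R] [CommRing S]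

variable (p) in
/-- Addition of truncated Witt vectors of length `e`, as an operation on `e`-tuples. -/
def wadd (x y : Fin e → R) (m : Fin e) : R :=
  (TruncatedWittVector.mk p x + TruncatedWittVector.mk p y).coeff m

theorem wadd_assoc (x y z : Fin e → R) :
    wadd p (wadd p x y) z = wadd p x (wadd p y z) := by
  have h : ∀ u v : Fin e → R, TruncatedWittVector.mk p (wadd p u v) =
      TruncatedWittVector.mk p u + TruncatedWittVector.mk p v := fun u v => by
    ext i
    rfl
  funext m
  rw [wadd, h, add_assoc, ← h]
  rfl

theorem wadd_zero (x : Fin e → R) : wadd p x 0 = x := by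
  have h : TruncatedWittVector.mk p (0 : Fin e → R) = 0 := by
    ext i
    simp
  funext m
  rw [wadd, h, add_zero, TruncatedWittVector.coeff_mk]

theorem wadd_coeff_eq_add_coeff (u v : WittVector p R) (m : Fin e) :
    wadd p (fun i : Fin e => u.coeff i) (fun i => v.coeff i) m = (u + v).coeff m := by
  rw [← WittVector.coeff_truncateFun, WittVector.truncateFun_add]
  rfl

theorem wadd_eq_aeval (u v : ℕ → R) (m : Fin e) :
    wadd p (fun i : Fin e => u i) (fun i => v i) m =
      MvPolynomial.aeval (fun z : Fin 2 × ℕ => if z.1 = 0 then u z.2 else v z.2)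
        (WittVector.wittAdd p m) := by
  have := wadd_coeff_eq_add_coeff (WittVector.mk p u) (WittVector.mk p v) m
  simp only [WittVector.coeff_mk] at this
  rw [this, WittVector.add_coeff, WittVector.peval]
  congr 2
  funext ⟨i, n⟩
  fin_cases i <;> simp

/-- Extension of an `e`-tuple by zero. -/
def extendZero (x : Fin e → R) (n : ℕ) : R := if h : n < e then x ⟨n, h⟩ else 0

theorem extendZero_coe (x : Fin e → R) (i : Fin e) : extendZero x i = x i := by
  simp [extendZero]

theorem map_wadd (f : R →+* S) (x y : Fin e → R) (m : Fin e) :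
    f (wadd p x y m) = wadd p (fun i => f (x i)) (fun i => f (y i)) m := by
  have h := wadd_eq_aeval (p := p) (extendZero x) (extendZero y) m
  have h' := wadd_eq_aeval (p := p) (fun n => f (extendZero x n)) (fun n => f (extendZero y n)) m
  simp only [extendZero_coe] at h h'
  rw [h, h', MvPolynomial.aeval_def, MvPolynomial.aeval_def, MvPolynomial.hom_eval₂]
  congr 1
  · exact RingHom.ext_int _ _
  · funext z
    split_ifs <;> rfl

theorem add_coeff_of_forall_lt (u v : WittVector p R) {k : ℕ} (hv : ∀ i < k, v.coeff i = 0) {m : ℕ}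
    (hm : m ≤ k) : (u + v).coeff m = u.coeff m + v.coeff m := by
  have htail : ∀ i < k, (WittVector.tail k u).coeff i = 0 := fun i hi => by
    simp [WittVector.tail, WittVector.select, not_le.2 hi]
  have hinit : ∀ i, k ≤ i → (WittVector.init k u).coeff i = 0 := fun i hi => by
    simp [WittVector.init, WittVector.select, not_lt.2 hi]
  set a := (WittVector.tail k u).shift k
  set c := v.shift k
  have hlow : ∀ i < k, (WittVector.verschiebung^[k] (a + c)).coeff i = 0 := fun i hi => by
    have : ∀ (n : ℕ) (w : WittVector p R), ∀ i < n,
        (WittVector.verschiebung^[n] w).coeff i = 0 := by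
      intro n
      induction n with
      | zero => simp
      | succ n ih =>
        intro w i hi
        rw [Function.iterate_succ_apply']
        rcases i with _ | i
        · exact WittVector.verschiebung_coeff_zero _
        · rw [WittVector.verschiebung_coeff_succ]
          exact ih w i (by omega)
    exact this k _ i hi
  have huv : u + v = WittVector.init k u + WittVector.verschiebung^[k] (a + c) := by
    rw [iterate_map_add, ← WittVector.eq_iterate_verschiebung htail,
      ← WittVector.eq_iterate_verschiebung hv, ← add_assoc, WittVector.init_add_tail]
  have hdisj : ∀ i, (WittVector.init k u).coeff i = 0 ∨
      (WittVector.verschiebung^[k] (a + c)).coeff i = 0 := fun i => by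
    rcases lt_or_ge i k with h | h
    · exact Or.inr (hlow i h)
    · exact Or.inl (hinit i h)
  rw [huv, WittVector.coeff_add_of_disjoint _ _ _ hdisj]
  rcases hm.lt_or_eq with h | rfl
  · rw [hlow m h, hv m h]
    simp [WittVector.init, WittVector.select, h]
  · have := WittVector.iterate_verschiebung_coeff (a + c) m 0
    rw [zero_add] at this
    rw [this, hinit m le_rfl, WittVector.add_coeff_zero, zero_add]
    simp [a, c, WittVector.shift_coeff, WittVector.tail, WittVector.select]

theorem wadd_single (x : Fin e → R) {k m : Fin e} (hm : m ≤ k) (t : R) :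
    wadd p x (Pi.single k t) m = x m + Pi.single (M := fun _ => R) k t m := by
  have h := wadd_coeff_eq_add_coeff (WittVector.mk p (extendZero x))
    (WittVector.mk p (extendZero (Pi.single k t))) m
  rw [add_coeff_of_forall_lt _ _ (k := k) _ hm] at h
  · simpa only [WittVector.coeff_mk, extendZero_coe] using h
  · intro i hi
    rw [WittVector.coeff_mk, extendZero]
    split_ifs with hie
    · exact Pi.single_eq_of_ne (by
        rintro rfl
        exact lt_irrefl _ hi) _
    · rfl

end WittAddition

section Expansion

open MvPowerSeries

variable {p e : ℕ} [Fact p.Prime] {K : Type*} [Field K] [CharP K p] {b : Fin e → K}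

/-- The power series `H_m(b, Y)`. -/
def wittShift (p : ℕ) [Fact p.Prime] (b : Fin e → K) (m : Fin e) : MvPowerSeries (Fin e) K :=
  wadd p (fun i => C (b i)) X m

omit [CharP K p] in
theorem constantCoeff_wittShift (m : Fin e) : constantCoeff (wittShift p b m) = b m := by
  have h0 : (fun i : Fin e => constantCoeff (X i : MvPowerSeries (Fin e) K)) = 0 := by
    funext i
    simp
  rw [wittShift, map_wadd, h0, wadd_zero]
  simp

/-- Approximation of the expansion homomorphism modulo a box ideal. -/
def IsApprox (p : ℕ) [Fact p.Prime] (b : Fin e → K) (n : ℕ)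
    (φ : K →+* MvPowerSeries (Fin e) K ⧸ boxIdeal p (Fin e) K n) : Prop :=
  (∀ m, φ (b m) = Ideal.Quotient.mk _ (wittShift p b m)) ∧
    ∀ x f, Ideal.Quotient.mk _ f = φ x → constantCoeff f = x

theorem IsApprox.unique (hb : IsPBasis p b) {n : ℕ}
    {φ χ : K →+* MvPowerSeries (Fin e) K ⧸ boxIdeal p (Fin e) K n}
    (hφ : IsApprox p b n φ) (hχ : IsApprox p b n χ) : φ = χ := by
  ext x
  have hmem : ∀ k (f : MvPowerSeries (Fin e) K), Ideal.Quotient.mk (boxIdeal p (Fin e) K n) f ∈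
      (boxIdeal p (Fin e) K k).map (Ideal.Quotient.mk (boxIdeal p (Fin e) K n)) ↔
      f ∈ boxIdeal p (Fin e) K k ⊔ boxIdeal p (Fin e) K n := fun k f => by
    rw [← Ideal.mem_comap, Ideal.comap_map_of_surjective' _ Ideal.Quotient.mk_surjective,
      Ideal.mk_ker]
  have := hb.sub_mem (fun k => (boxIdeal p (Fin e) K k).map
    (Ideal.Quotient.mk (boxIdeal p (Fin e) K n))) ?_ (f := φ) (g := χ)
    (fun m => by rw [hφ.1, hχ.1]) ?_ n x
  · rw [Ideal.map_quotient_self, Ideal.mem_bot, sub_eq_zero] at this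
    exact this
  · intro k u v huv
    obtain ⟨u, rfl⟩ := Ideal.Quotient.mk_surjective u
    obtain ⟨v, rfl⟩ := Ideal.Quotient.mk_surjective v
    obtain ⟨w, hw, hw'⟩ := (Ideal.mem_map_iff_of_surjective _
      Ideal.Quotient.mk_surjective).1 huv
    have hu : Ideal.Quotient.mk (boxIdeal p (Fin e) K n) u = Ideal.Quotient.mk _ (v + w) := by
      rw [map_add, hw']
      ring
    rw [hu, ← map_pow, ← map_pow, ← map_sub]
    exact Ideal.mem_map_of_mem _ (pow_sub_pow_mem_boxIdeal _ _ _ (by simpa using hw))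
  · intro x
    obtain ⟨u, hu⟩ := Ideal.Quotient.mk_surjective (φ x)
    obtain ⟨v, hv⟩ := Ideal.Quotient.mk_surjective (χ x)
    rw [← hu, ← hv, ← map_sub]
    refine Ideal.mem_map_of_mem _ (mem_boxIdeal_zero.2 ?_)
    rw [map_sub, hφ.2 x u hu, hχ.2 x v hv, sub_self]

theorem exists_isApprox (hb : IsPBasis p b) (n : ℕ) : ∃ φ, IsApprox p b n φ := by
  have := (Fact.out : p.Prime)
  have : CharP (MvPowerSeries (Fin e) K) p :=
    charP_of_injective_ringHom (C_injective (σ := Fin e) (R := K)) p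
  induction n with
  | zero =>
    refine ⟨(Ideal.Quotient.mk _).comp C, fun m => ?_, fun x f hf => ?_⟩
    · rw [RingHom.comp_apply, Ideal.Quotient.eq, mem_boxIdeal_zero, map_sub,
        constantCoeff_wittShift, constantCoeff_C, sub_self]
    · rw [RingHom.comp_apply, Ideal.Quotient.eq, mem_boxIdeal_zero, map_sub, constantCoeff_C,
        sub_eq_zero] at hf
      exact hf
  | succ n ih =>
    obtain ⟨φ, hφ⟩ := ih
    let F : MvPowerSeries (Fin e) K ⧸ boxIdeal p (Fin e) K n →+*
        MvPowerSeries (Fin e) K ⧸ boxIdeal p (Fin e) K (n + 1) :=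
      Ideal.Quotient.lift _ ((Ideal.Quotient.mk _).comp (frobenius _ p)) fun f hf => by
        rw [RingHom.comp_apply, Ideal.Quotient.eq_zero_iff_mem, frobenius_def]
        have := pow_sub_pow_mem_boxIdeal n f 0 (by simpa using hf)
        simpa [(Fact.out : p.Prime).ne_zero] using this
    have hF : ∀ f, F (Ideal.Quotient.mk _ f) = Ideal.Quotient.mk _ (f ^ p) := fun f => rfl
    have hh : ∀ m, (Ideal.Quotient.mk (boxIdeal p (Fin e) K (n + 1)) (wittShift p b m)) ^ p =
        (F.comp φ) (b m) := fun m => by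
      rw [RingHom.comp_apply, hφ.1, hF, map_pow]
    refine ⟨hb.lift (F.comp φ) _ hh, fun m => hb.lift_basis _ _ hh m, fun x f hf => ?_⟩
    have hcc : ∀ g g' : MvPowerSeries (Fin e) K, Ideal.Quotient.mk (boxIdeal p (Fin e) K (n + 1)) g
        = Ideal.Quotient.mk _ g' → constantCoeff g = constantCoeff g' := fun g g' h => by
      rw [Ideal.Quotient.eq] at h
      have := mem_boxIdeal_zero.1 (boxIdeal_le (Nat.zero_le _) h)
      rwa [map_sub, sub_eq_zero] at this
    choose r hr using fun y => Ideal.Quotient.mk_surjective (φ y)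
    have key : hb.lift (F.comp φ) _ hh x = Ideal.Quotient.mk _
        (∑ i, r (hb.coord x i) ^ p * ∏ m, wittShift p b m ^ (i m : ℕ)) := by
      conv_lhs => rw [← hb.sum_coord x]
      simp only [map_sum, map_mul, map_prod, map_pow, hb.lift_basis]
      refine Finset.sum_congr rfl fun i _ => ?_
      rw [← map_pow, hb.lift_pow, RingHom.comp_apply, ← hr, hF, map_pow]
    rw [hcc _ _ (hf.trans key)]
    simp only [map_sum, map_mul, map_prod, map_pow, constantCoeff_wittShift]
    conv_rhs => rw [← hb.sum_coord x]
    refine Finset.sum_congr rfl fun i _ => ?_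
    rw [hφ.2 _ _ (hr _)]

/-- A `p`-basis determines a ring homomorphism to power series, lifting the identity modulo the
variables and sending `b` to its generic Witt translate. -/
theorem exists_expansion (hb : IsPBasis p b) : ∃ Φ : K →+* MvPowerSeries (Fin e) K,
    (∀ x, constantCoeff (Φ x) = x) ∧ ∀ m, Φ (b m) = wittShift p b m := by
  choose φ hφ using exists_isApprox hb
  choose r hr using fun n x => Ideal.Quotient.mk_surjective (φ n x)
  have compat : ∀ {m n : ℕ} (h : m ≤ n) (x : K),
      Ideal.Quotient.factor (boxIdeal_le h) (φ n x) = φ m x := fun {m n} h x => by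
    have : (Ideal.Quotient.factor (boxIdeal_le h)).comp (φ n) = φ m := by
      refine IsApprox.unique hb ⟨fun k => ?_, fun x f hf => ?_⟩ (hφ m)
      · rw [RingHom.comp_apply, (hφ n).1, Ideal.Quotient.factor_mk]
      · rw [RingHom.comp_apply, ← hr n x, Ideal.Quotient.factor_mk, Ideal.Quotient.eq] at hf
        have := mem_boxIdeal_zero.1 (boxIdeal_le (Nat.zero_le _) hf)
        rw [map_sub, sub_eq_zero] at this
        rw [this, (hφ n).2 x _ (hr n x)]
    rw [← this, RingHom.comp_apply]
  have rcompat : ∀ {m n : ℕ} (_ : m ≤ n) (x : K), r n x - r m x ∈ boxIdeal p (Fin e) K m :=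
    fun {m n} h x => by
      rw [← Ideal.Quotient.eq, hr m, ← compat h, ← hr n, Ideal.Quotient.factor_mk]
  let Φ : K → MvPowerSeries (Fin e) K := fun x d => coeff d (r d.degree x)
  have hΦc : ∀ x d, coeff d (Φ x) = coeff d (r d.degree x) := fun x d => rfl
  have hΦ : ∀ n x, Ideal.Quotient.mk (boxIdeal p (Fin e) K n) (Φ x) = φ n x := fun n x => by
    rw [← hr n, Ideal.Quotient.eq]
    intro d hd
    rw [map_sub, sub_eq_zero, hΦc]
    rcases le_total d.degree n with h | h
    · have := rcompat h x d (lt_pow_degree d)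
      rw [map_sub, sub_eq_zero] at this
      exact this.symm
    · have := rcompat h x d hd
      rwa [map_sub, sub_eq_zero] at this
  have ext' : ∀ f g : MvPowerSeries (Fin e) K, (∀ n, Ideal.Quotient.mk (boxIdeal p (Fin e) K n) f =
      Ideal.Quotient.mk _ g) → f = g := fun f g h =>
    eq_of_sub_mem_boxIdeal (p := p) fun n => Ideal.Quotient.eq.1 (h n)
  refine ⟨⟨⟨⟨Φ, ?_⟩, ?_⟩, ?_, ?_⟩, fun x => (hφ 0).2 x _ (hΦ 0 x), fun m => ?_⟩
  · exact ext' _ _ fun n => by rw [hΦ, map_one, map_one]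
  · intro x y
    exact ext' _ _ fun n => by simp only [hΦ, map_mul]
  · exact ext' _ _ fun n => by
      change Ideal.Quotient.mk _ (Φ 0) = _
      rw [hΦ, map_zero, map_zero]
  · intro x y
    refine ext' _ _ fun n => ?_
    change Ideal.Quotient.mk _ (Φ (x + y)) = Ideal.Quotient.mk _ (Φ x + Φ y)
    simp only [hΦ, map_add]
  · refine ext' _ _ fun n => ?_
    change Ideal.Quotient.mk _ (Φ (b m)) = _
    rw [hΦ, (hφ n).1]

end Expansion

section Coefficients

open MvPowerSeries

variable {p e : ℕ} [Fact p.Prime] {K : Type*} [Field K] [CharP K p] {b : Fin e → K}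

/-- A multi-index as a finitely supported function. -/
abbrev toExp (i : Fin e → ℕ) : Fin e →₀ ℕ := Finsupp.equivFunOnFinite.symm i

/-- A pair of multi-indices as an exponent in two sets of variables. -/
def pairExp (i j : Fin e → ℕ) : Fin 2 × Fin e →₀ ℕ :=
  Finsupp.equivFunOnFinite.symm fun z => if z.1 = 0 then i z.2 else j z.2

theorem wittHmod_eq (m : Fin e) : wittHmod p m =
    wadd p (fun i : Fin e => MvPolynomial.X (0, (i : ℕ)))
      (fun i : Fin e => MvPolynomial.X (1, (i : ℕ))) m := by
  rw [wadd_eq_aeval (fun n => MvPolynomial.X (0, n)) (fun n => MvPolynomial.X (1, n)), wittHmod,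
    ← AlgHom.coe_toRingHom]
  congr 1
  refine MvPolynomial.ringHom_ext' (RingHom.ext_int _ _) fun z => ?_
  rcases z with ⟨z, n⟩
  fin_cases z <;> simp

theorem wittDelta_eq (i j : Fin e → ℕ) :
    wittDelta p e b i j = coeff (toExp j) (∏ m, wittShift p b m ^ i m) := by
  have hj : yExp e j = (toExp j).mapDomain Fin.val := by
    rw [yExp, Finsupp.mapDomain, Finsupp.sum_fintype _ _ (by simp)]
    rfl
  have hc : (∏ m, wittShift p b m ^ i m) = MvPolynomial.coeToMvPowerSeries.ringHom
      (∏ m, wadd p (fun i => MvPolynomial.C (b i)) MvPolynomial.X m ^ i m) := by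
    simp only [map_prod, map_pow, map_wadd, wittShift]
    simp
  rw [hc, MvPolynomial.coeToMvPowerSeries.ringHom_apply, MvPolynomial.coeff_coe, wittDelta,
    ← MvPolynomial.coe_eval₂Hom, hj,
    ← MvPolynomial.coeff_rename_mapDomain _ Fin.val_injective]
  congr 1
  rw [← AlgHom.coe_toRingHom]
  simp only [map_prod, map_pow, wittHmod_eq, map_wadd]
  congr! 4
  · simp
  · simp

theorem cast_wittAlpha (i j l : Fin e → ℕ) :
    (ZMod.cast (wittAlpha p e i j l) : K) = coeff (pairExp i j)
      (∏ m, wadd p (fun i : Fin e => (X (0, i) : MvPowerSeries (Fin 2 × Fin e) K))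
        (fun i => X (1, i)) m ^ l m) := by
  have hinj : Function.Injective (Prod.map id Fin.val : Fin 2 × Fin e → Fin 2 × ℕ) :=
    Function.injective_id.prodMap Fin.val_injective
  have hj : xyExp e i j = (pairExp i j).mapDomain (Prod.map id Fin.val) := by
    rw [xyExp, Finsupp.mapDomain, Finsupp.sum_fintype _ _ (by simp), Fintype.sum_prod_type]
    simp [Fin.sum_univ_two, pairExp, Finset.sum_add_distrib]
  have hc : (∏ m, wadd p (fun i : Fin e => (X (0, i) : MvPowerSeries (Fin 2 × Fin e) K))
        (fun i => X (1, i)) m ^ l m) = MvPolynomial.coeToMvPowerSeries.ringHom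
      (∏ m, wadd p (fun i : Fin e => MvPolynomial.X (0, i))
        (fun i => MvPolynomial.X (1, i)) m ^ l m) := by
    simp only [map_prod, map_pow, map_wadd]
    simp
  rw [hc, MvPolynomial.coeToMvPowerSeries.ringHom_apply, MvPolynomial.coeff_coe, wittAlpha,
    ← ZMod.castHom_apply (h := dvd_refl p), ← MvPolynomial.coeff_map, hj,
    ← MvPolynomial.coeff_rename_mapDomain _ hinj]
  congr 1
  rw [← AlgHom.coe_toRingHom]
  simp only [map_prod, map_pow, wittHmod_eq, map_wadd]
  simp

theorem sum_antidiagonal_toExp {M : Type*} [AddCommMonoid M] (i : Fin e → ℕ)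
    (g : (Fin e →₀ ℕ) → (Fin e →₀ ℕ) → M) :
    ∑ x ∈ Finset.HasAntidiagonal.antidiagonal (toExp i), g x.1 x.2 =
      ∑ k ∈ Finset.Iic i, g (toExp k) (toExp (i - k)) := by
  refine Finset.sum_nbij' (fun x => x.1) (fun k => (toExp k, toExp (i - k))) ?_ ?_ ?_ ?_ ?_
  · intro x hx
    rw [Finset.HasAntidiagonal.mem_antidiagonal] at hx
    rw [Finset.mem_Iic]
    intro m
    exact (Nat.le_add_right _ _).trans_eq (DFunLike.congr_fun hx m)
  · intro k hk
    rw [Finset.mem_Iic] at hk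
    rw [Finset.HasAntidiagonal.mem_antidiagonal]
    ext m
    exact Nat.add_sub_cancel' (hk m)
  · intro x hx
    rw [Finset.HasAntidiagonal.mem_antidiagonal] at hx
    ext m
    · simp
    · exact Nat.sub_eq_of_eq_add' (DFunLike.congr_fun hx m).symm
  · intro k hk
    rfl
  · intro x hx
    rw [Finset.HasAntidiagonal.mem_antidiagonal] at hx
    congr 1
    · ext m
      simp
    · ext m
      exact (Nat.sub_eq_of_eq_add' (DFunLike.congr_fun hx m).symm).symm

end Coefficients

section Iterativity

open MvPowerSeries

variable {p e : ℕ} [Fact p.Prime] {K : Type*} [Field K] [CharP K p] {b : Fin e → K}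

theorem pairExp_add (i j i' j' : Fin e → ℕ) :
    pairExp (i + i') (j + j') = pairExp i j + pairExp i' j' := by
  ext ⟨z, m⟩
  fin_cases z <;> simp [pairExp]

/-- The exponent in the first or second set of variables. -/
def sliceExp (z : Fin 2) (d : Fin 2 × Fin e →₀ ℕ) : Fin e →₀ ℕ := toExp fun m => d (z, m)

theorem sliceExp_add (z : Fin 2) (d d' : Fin 2 × Fin e →₀ ℕ) :
    sliceExp z (d + d') = sliceExp z d + sliceExp z d' := by
  ext m
  simp [sliceExp]

theorem sliceExp_zero (z : Fin 2) : sliceExp z (0 : Fin 2 × Fin e →₀ ℕ) = 0 := by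
  ext m
  simp [sliceExp]

theorem pairExp_sliceExp (d : Fin 2 × Fin e →₀ ℕ) :
    pairExp (sliceExp 0 d) (sliceExp 1 d) = d := by
  ext ⟨z, m⟩
  fin_cases z <;> simp [pairExp, sliceExp]

theorem sliceExp_pairExp_zero (i j : Fin e → ℕ) : sliceExp 0 (pairExp i j) = toExp i := rfl

theorem sliceExp_pairExp_one (i j : Fin e → ℕ) : sliceExp 1 (pairExp i j) = toExp j := rfl

/-- The power series whose coefficients are obtained by applying `Φ` to the coefficients of a
power series in the second set of variables. -/
def expandFun (Φ : K →+* MvPowerSeries (Fin e) K) (f : MvPowerSeries (Fin e) K) :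
    MvPowerSeries (Fin 2 × Fin e) K :=
  fun d => coeff (sliceExp 0 d) (Φ (coeff (sliceExp 1 d) f))

theorem coeff_expandFun (Φ : K →+* MvPowerSeries (Fin e) K) (f : MvPowerSeries (Fin e) K)
    (d : Fin 2 × Fin e →₀ ℕ) :
    coeff d (expandFun Φ f) = coeff (sliceExp 0 d) (Φ (coeff (sliceExp 1 d) f)) := rfl

theorem expandFun_mul (Φ : K →+* MvPowerSeries (Fin e) K) (f g : MvPowerSeries (Fin e) K) :
    expandFun Φ (f * g) = expandFun Φ f * expandFun Φ g := by
  classical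
  ext d
  rw [coeff_expandFun, coeff_mul, coeff_mul, map_sum, map_sum]
  simp only [map_mul, coeff_mul, coeff_expandFun]
  rw [← Finset.sum_product']
  refine Finset.sum_nbij' (fun x => (pairExp x.2.1 x.1.1, pairExp x.2.2 x.1.2))
    (fun y => ((sliceExp 1 y.1, sliceExp 1 y.2), (sliceExp 0 y.1, sliceExp 0 y.2))) ?_ ?_ ?_ ?_ ?_
  · intro x hx
    rw [Finset.mem_product, Finset.HasAntidiagonal.mem_antidiagonal,
      Finset.HasAntidiagonal.mem_antidiagonal] at hx
    rw [Finset.HasAntidiagonal.mem_antidiagonal, ← pairExp_add, ← Finsupp.coe_add,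
      ← Finsupp.coe_add, hx.1, hx.2, pairExp_sliceExp]
  · intro y hy
    rw [Finset.HasAntidiagonal.mem_antidiagonal] at hy
    rw [Finset.mem_product, Finset.HasAntidiagonal.mem_antidiagonal,
      Finset.HasAntidiagonal.mem_antidiagonal, ← sliceExp_add, ← sliceExp_add, hy]
    exact ⟨rfl, rfl⟩
  · intro x _
    simp [sliceExp_pairExp_zero, sliceExp_pairExp_one]
  · intro y _
    simp [pairExp_sliceExp]
  · intro x _
    simp [sliceExp_pairExp_zero, sliceExp_pairExp_one]

/-- `expandFun` as a ring homomorphism. -/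
def expandHom (Φ : K →+* MvPowerSeries (Fin e) K) :
    MvPowerSeries (Fin e) K →+* MvPowerSeries (Fin 2 × Fin e) K where
  toFun := expandFun Φ
  map_one' := by
    classical
    ext d
    rw [coeff_expandFun, coeff_one, coeff_one]
    by_cases h1 : sliceExp 1 d = 0
    · rw [if_pos h1, map_one, coeff_one]
      by_cases h0 : sliceExp 0 d = 0
      · rw [if_pos h0, if_pos]
        rw [← pairExp_sliceExp d, h0, h1]
        ext
        simp [pairExp]
      · rw [if_neg h0, if_neg]
        rintro rfl
        exact h0 (sliceExp_zero 0)
    · rw [if_neg h1, map_zero, map_zero, if_neg]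
      rintro rfl
      exact h1 (sliceExp_zero 1)
  map_mul' := expandFun_mul Φ
  map_zero' := by
    ext d
    simp [coeff_expandFun]
  map_add' f g := by
    ext d
    simp [coeff_expandFun]

theorem coeff_expandHom (Φ : K →+* MvPowerSeries (Fin e) K) (f : MvPowerSeries (Fin e) K)
    (d : Fin 2 × Fin e →₀ ℕ) :
    coeff d (expandHom Φ f) = coeff (sliceExp 0 d) (Φ (coeff (sliceExp 1 d) f)) := rfl

theorem expandHom_C (Φ : K →+* MvPowerSeries (Fin e) K) (a : K) :
    expandHom Φ (C a) = rename (fun i : Fin e => ((0 : Fin 2), i)) (Φ a) := by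
  classical
  ext d
  let ε : Fin e ↪ Fin 2 × Fin e := ⟨fun i => (0, i), fun i j h => congrArg Prod.snd h⟩
  rw [coeff_expandHom, coeff_C]
  change _ = coeff d (rename ε (Φ a))
  by_cases h : sliceExp 1 d = 0
  · have hd : d = Finsupp.embDomain ε (sliceExp 0 d) := by
      conv_lhs => rw [← pairExp_sliceExp d, h]
      ext ⟨z, m⟩
      fin_cases z
      · exact (Finsupp.embDomain_apply_self ε (sliceExp 0 d) m).symm
      · rw [Finsupp.embDomain_of_notMem_range]
        · rfl
        · rintro ⟨i, hi⟩
          exact zero_ne_one (congrArg Prod.fst hi)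
    rw [if_pos h]
    conv_rhs => rw [hd, coeff_embDomain_rename]
  · rw [if_neg h, map_zero, map_zero, coeff_rename_eq_zero]
    rintro ⟨u, rfl⟩
    refine h ?_
    ext m
    change Finsupp.mapDomain ε u (1, m) = 0
    refine Finsupp.mapDomain_of_notMem_range _ _ ?_
    rintro ⟨i, hi⟩
    exact zero_ne_one (congrArg Prod.fst hi)

theorem expandHom_X (Φ : K →+* MvPowerSeries (Fin e) K) (m : Fin e) :
    expandHom Φ (X m) = X (1, m) := by
  classical
  ext d
  rw [coeff_expandHom, coeff_X, coeff_X]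
  by_cases h1 : sliceExp 1 d = Finsupp.single m 1
  · rw [if_pos h1, map_one, coeff_one]
    by_cases h0 : sliceExp 0 d = 0
    · rw [if_pos h0, if_pos]
      rw [← pairExp_sliceExp d, h0, h1]
      ext ⟨z, k⟩
      fin_cases z <;> simp [pairExp, Finsupp.single_apply]
    · rw [if_neg h0, if_neg]
      rintro rfl
      refine h0 ?_
      ext k
      simp [sliceExp]
  · rw [if_neg h1, map_zero, map_zero, if_neg]
    rintro rfl
    refine h1 ?_
    ext k
    simp [sliceExp, Finsupp.single_apply]

/-- The power series of the group law in two sets of variables. -/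
def wittLaw (p e : ℕ) [Fact p.Prime] (K : Type*) [Field K] (m : Fin e) :
    MvPowerSeries (Fin 2 × Fin e) K :=
  wadd p (fun i => X (0, i)) (fun i => X (1, i)) m

omit [CharP K p] in
theorem constantCoeff_wittLaw (m : Fin e) : constantCoeff (wittLaw p e K m) = 0 := by
  rw [wittLaw, map_wadd]
  simp only [constantCoeff_X]
  exact congrFun (wadd_zero (0 : Fin e → K)) m

omit [CharP K p] in
theorem hasSubst_wittLaw : HasSubst (wittLaw p e K) :=
  hasSubst_of_constantCoeff_zero constantCoeff_wittLaw

theorem expandHom_expansion (hb : IsPBasis p b) {Φ : K →+* MvPowerSeries (Fin e) K}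
    (h0 : ∀ x, constantCoeff (Φ x) = x) (hΦ : ∀ m, Φ (b m) = wittShift p b m) (x : K) :
    expandHom Φ (Φ x) = subst (wittLaw p e K) (Φ x) := by
  let S : K →+* MvPowerSeries (Fin 2 × Fin e) K :=
    (substAlgHom (R := K) (hasSubst_wittLaw (p := p))).toRingHom.comp Φ
  have hS : ∀ x, S x = subst (wittLaw p e K) (Φ x) := fun x => by
    simp [S, coe_substAlgHom]
  rw [← hS]
  refine eq_of_sub_mem_boxIdeal (p := p) fun n =>
    hb.sub_mem (boxIdeal p _ K) pow_sub_pow_mem_boxIdeal (f := (expandHom Φ).comp Φ) (g := S)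
      (fun m => ?_) (fun x => ?_) n x
  · rw [RingHom.comp_apply, RingHom.comp_apply, hΦ, wittShift, map_wadd, map_wadd]
    simp only [expandHom_C, hΦ, expandHom_X]
    have h1 : ∀ i, rename (fun i : Fin e => ((0 : Fin 2), i)) (wittShift p b i) =
        wadd p (fun i => C (b i)) (fun i => X (0, i)) i := fun i => by
      rw [wittShift, ← AlgHom.coe_toRingHom, map_wadd]
      simp
    simp only [h1]
    rw [wadd_assoc]
    simp [substAlgHom_apply, subst_C, subst_X hasSubst_wittLaw]
    rfl
  · rw [mem_boxIdeal_zero, map_sub, hS, sub_eq_zero]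
    trans x
    · rw [RingHom.comp_apply, ← coeff_zero_eq_constantCoeff_apply, coeff_expandHom, sliceExp_zero,
        sliceExp_zero, coeff_zero_eq_constantCoeff_apply, coeff_zero_eq_constantCoeff_apply, h0, h0]
    · have := constantCoeff_subst_eq_zero (hasSubst_wittLaw (p := p) (K := K))
        constantCoeff_wittLaw (f := Φ x - C x) (by simp [h0])
      rw [subst_sub hasSubst_wittLaw, subst_C, map_sub, constantCoeff_C, sub_eq_zero] at this
      exact this.symm

theorem coeff_coeff_expansion (hb : IsPBasis p b) {Φ : K →+* MvPowerSeries (Fin e) K}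
    (h0 : ∀ x, constantCoeff (Φ x) = x) (hΦ : ∀ m, Φ (b m) = wittShift p b m) (i j : Fin e → ℕ)
    (x : K) : coeff (toExp i) (Φ (coeff (toExp j) (Φ x))) =
      ∑ᶠ l : Fin e → ℕ, ZMod.cast (wittAlpha p e i j l) * coeff (toExp l) (Φ x) := by
  have h := congrArg (coeff (pairExp i j)) (expandHom_expansion hb h0 hΦ x)
  rw [coeff_expandHom, coeff_subst hasSubst_wittLaw, sliceExp_pairExp_zero,
    sliceExp_pairExp_one] at h
  rw [h, ← finsum_comp_equiv (Finsupp.equivFunOnFinite : (Fin e →₀ ℕ) ≃ (Fin e → ℕ)).symm]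
  refine finsum_congr fun l => ?_
  rw [cast_wittAlpha, smul_eq_mul, mul_comm, Finsupp.prod_fintype _ _ (by simp)]
  rfl

end Iterativity

section Strictness

open MvPowerSeries

variable {p e : ℕ} [Fact p.Prime] {K : Type*} [Field K] [CharP K p] {b : Fin e → K}

theorem coeff_pow_mul_of_lt (n : ℕ) (f g : MvPowerSeries (Fin e) K) (d : Fin e →₀ ℕ)
    (hd : ∀ s, d s < p ^ n) :
    coeff d (f ^ p ^ n * g) = constantCoeff f ^ p ^ n * coeff d g := by
  have h : f ^ p ^ n - C (constantCoeff f) ^ p ^ n ∈ boxIdeal p (Fin e) K n := by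
    clear hd
    induction n with
    | zero => simp [mem_boxIdeal_zero]
    | succ n ih =>
      rw [pow_succ, pow_mul, pow_mul]
      exact pow_sub_pow_mem_boxIdeal _ _ _ ih
  have h' := Ideal.mul_mem_right g _ h d hd
  rw [sub_mul, map_sub, sub_eq_zero, ← map_pow, coeff_C_mul] at h'
  exact h'

omit [CharP K p] in
theorem coeff_single_wittShift {k m : Fin e} (hk : k ≤ m) :
    coeff (Finsupp.single m 1) (wittShift p b k) = if k = m then 1 else 0 := by
  classical
  let ε : Unit ↪ Fin e := ⟨fun _ => m, fun _ _ _ => rfl⟩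
  have hX : (fun i => killCompl ε (X i : MvPowerSeries (Fin e) K)) = Pi.single m (X ()) := by
    funext i
    by_cases h : i = m
    · subst h
      rw [Pi.single_eq_same]
      exact killCompl_X (e := ε) ()
    · rw [Pi.single_eq_of_ne h]
      refine killCompl_X_eq_zero ?_
      rintro ⟨_, rfl⟩
      exact h rfl
  have h : killCompl ε (wittShift p b k) =
      C (b k) + Pi.single (M := fun _ => MvPowerSeries Unit K) m (X ()) k := by
    rw [wittShift, ← AlgHom.coe_toRingHom, map_wadd]
    simp only [AlgHom.coe_toRingHom, hX]
    rw [wadd_single _ hk, killCompl_C]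
  have hs : Finsupp.single m 1 = Finsupp.embDomain ε (Finsupp.single () 1) :=
    (Finsupp.embDomain_single ε () 1).symm
  rw [hs, ← coeff_killCompl, h, map_add, coeff_C, if_neg (by simp), zero_add]
  split_ifs with hkm
  · subst hkm
    rw [Pi.single_eq_same, coeff_X, if_pos rfl]
  · rw [Pi.single_eq_of_ne hkm, map_zero]

/-- The linear coefficient of an expansion homomorphism is a derivation. -/
def linearCoeff (Φ : K →+* MvPowerSeries (Fin e) K) (h0 : ∀ x, constantCoeff (Φ x) = x)
    (m : Fin e) : Derivation ℤ K K :=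
  Derivation.mk' ((coeff (R := K) (Finsupp.single m 1)).toAddMonoidHom.comp
    Φ.toAddMonoidHom).toIntLinearMap fun x y => by
    have h : ∀ f : MvPowerSeries (Fin e) K,
        coeff (Finsupp.single m 1) f = constantCoeff (pderiv K m f) := fun f => by
      rw [← coeff_zero_eq_constantCoeff_apply, coeff_pderiv]
      simp
    change coeff _ (Φ (x * y)) = x • coeff _ (Φ y) + y • coeff _ (Φ x)
    rw [h, h, h, map_mul, Derivation.leibniz, map_add, smul_eq_mul, smul_eq_mul, map_mul, map_mul,
      h0, h0, smul_eq_mul, smul_eq_mul]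

theorem linearCoeff_apply (Φ : K →+* MvPowerSeries (Fin e) K) (h0 : ∀ x, constantCoeff (Φ x) = x)
    (m : Fin e) (x : K) : linearCoeff Φ h0 m x = coeff (Finsupp.single m 1) (Φ x) := rfl

omit [Fact p.Prime] in
theorem derivation_pow_char (d : Derivation ℤ K K) (x : K) : d (x ^ p) = 0 := by
  rw [Derivation.leibniz_pow, ← Nat.cast_smul_eq_nsmul K, CharP.cast_eq_zero, zero_smul]

theorem derivation_monomial (d : Derivation ℤ K K) (hb : ∀ m, b m ≠ 0) (n : Fin e → ℕ)
    (s : Finset (Fin e)) : d (∏ m ∈ s, b m ^ n m) =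
      ∑ k ∈ s, ((b k)⁻¹ * d (b k)) * (n k * ∏ m ∈ s, b m ^ n m) := by
  classical
  induction s using Finset.induction_on with
  | empty => simp
  | insert a s ha ih =>
    have hpow : d (b a ^ n a) = (b a)⁻¹ * d (b a) * (n a * b a ^ n a) := by
      rw [Derivation.leibniz_pow]
      rcases n a with _ | k
      · simp
      · have := hb a
        simp only [Nat.add_sub_cancel, nsmul_eq_mul, smul_eq_mul]
        field_simp
        ring
    rw [Finset.prod_insert ha, Derivation.leibniz, ih, Finset.sum_insert ha, hpow, add_comm,
      smul_eq_mul, smul_eq_mul, Finset.mul_sum]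
    congr 1
    · ring
    · exact Finset.sum_congr rfl fun k _ => by ring

omit [CharP K p] in
theorem IsPBasis.ne_zero (hb : IsPBasis p b) (m : Fin e) : b m ≠ 0 := by
  have hp := (Fact.out : p.Prime)
  intro h
  let k : Fin e → Fin p := fun i => if i = m then ⟨1, hp.one_lt⟩ else ⟨0, hp.pos⟩
  have hk := hb.coord_monomial k
  have hz : ∏ i, b i ^ (k i : ℕ) = 0 :=
    Finset.prod_eq_zero (Finset.mem_univ m) (by simp [k, h])
  have h0 : hb.coord (∏ i, b i ^ (k i : ℕ)) = 0 := hb.coord_eq (by simp [hz, hp.ne_zero])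
  rw [h0] at hk
  simpa using congrFun hk k

theorem IsPBasis.exists_pow_eq (hb : IsPBasis p b) {x : K}
    (h : ∀ k, ∑ i, ((i k : ℕ) : K) * (hb.coord x i ^ p * ∏ m, b m ^ (i m : ℕ)) = 0) :
    ∃ y, x = y ^ p := by
  have hp := (Fact.out : p.Prime)
  have hz : ∀ k i, ((i k : ℕ) : K) * hb.coord x i = 0 := fun k i => by
    have h1 : hb.coord 0 = fun i => ((i k : ℕ) : K) * hb.coord x i := hb.coord_eq (by
      rw [← h k]
      refine Finset.sum_congr rfl fun i _ => ?_
      rw [mul_pow, ← frobenius_def, map_natCast, mul_assoc])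
    have h2 : hb.coord 0 = 0 := hb.coord_eq (by simp [hp.ne_zero])
    rw [← congrFun h1 i, h2]
    rfl
  refine ⟨hb.coord x fun _ => ⟨0, hp.pos⟩, ?_⟩
  conv_lhs => rw [← hb.sum_coord x]
  rw [Finset.sum_eq_single fun _ => ⟨0, hp.pos⟩]
  · simp
  · intro i _ hi
    obtain ⟨k, hk⟩ := Function.ne_iff.1 hi
    have hne : ((i k : ℕ) : K) ≠ 0 := fun h => by
      rw [CharP.cast_eq_zero_iff K p] at h
      exact hk (Fin.ext (Nat.eq_zero_of_dvd_of_lt h (i k).2))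
    rw [(mul_eq_zero.1 (hz k i)).resolve_left hne, zero_pow hp.ne_zero, zero_mul]
  · simp

theorem linearCoeff_eq_zero_iff (hb : IsPBasis p b) {Φ : K →+* MvPowerSeries (Fin e) K}
    (h0 : ∀ x, constantCoeff (Φ x) = x) (hΦ : ∀ m, Φ (b m) = wittShift p b m) (x : K) :
    (∀ m, linearCoeff Φ h0 m x = 0) ↔ ∃ y, x = y ^ p := by
  classical
  constructor
  · intro h
    let M : Matrix (Fin e) (Fin e) K := fun m k => (b k)⁻¹ * linearCoeff Φ h0 m (b k)
    have hM : M.BlockTriangular id := fun m k (hkm : k < m) => by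
      simp only [M, linearCoeff_apply, hΦ]
      rw [coeff_single_wittShift (le_of_lt hkm), if_neg (ne_of_lt hkm), mul_zero]
    have hdet : M.det ≠ 0 := by
      rw [Matrix.det_of_isUpperTriangular hM]
      refine Finset.prod_ne_zero_iff.2 fun m _ => ?_
      simp only [M, linearCoeff_apply, hΦ]
      rw [coeff_single_wittShift le_rfl, if_pos rfl, mul_one]
      exact inv_ne_zero (hb.ne_zero m)
    refine hb.exists_pow_eq fun k => congrFun (Matrix.eq_zero_of_mulVec_eq_zero
      (v := fun k => ∑ i, ((i k : ℕ) : K) * (hb.coord x i ^ p * ∏ m, b m ^ (i m : ℕ)))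
      hdet ?_) k
    funext m
    refine Eq.trans ?_ (h m)
    conv_rhs => rw [← hb.sum_coord x, map_sum]
    simp only [Matrix.mulVec, dotProduct, Finset.mul_sum, Derivation.leibniz, derivation_pow_char,
      mul_zero, add_zero, derivation_monomial _ hb.ne_zero, smul_eq_mul]
    rw [Finset.sum_comm]
    refine Finset.sum_congr rfl fun i _ => Finset.sum_congr rfl fun k _ => ?_
    simp only [M]
    ring
  · rintro ⟨y, rfl⟩ m
    exact derivation_pow_char _ y

end Strictness

end WittHS

/-- Let `K` be a separably closed field of characteristic `p` with `[K : K^p] = p^e` and let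
`b : Fin e → K` be a `p`-basis of `K` (the monomials `b̄^𝐢`, `𝐢 ∈ [p]^e`, are linearly
independent over `K^p`).  Then the formulas
`D_𝐣(Σ_{𝐢∈[p^n]^e} α_𝐢^{p^n} b̄^𝐢) := Σ_{𝐢∈[p^n]^e} α_𝐢^{p^n} δ_𝐣^𝐢(b̄)` (for any
`n ≥ max(j_1,…,j_e)`) give a well-defined family `(D_𝐣)_{𝐣∈ℕ^e}` which is a strict
`W_e`-iterative Hasse–Schmidt derivation on `K` — so `(K, (D_𝐣))` is a model of `W_e`-DCF —
and which satisfies `D_𝐣(b̄^𝐢) = δ_𝐣^𝐢(b̄)` for all `𝐢, 𝐣`. -/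
theorem exists_WeDCF_of_pBasis (p e : ℕ) [Fact p.Prime] (he : 1 ≤ e)
    (K : Type*) [Field K] [CharP K p] (hsc : IsSepClosed K)
    (hdeg : Module.finrank ↥(RingHom.fieldRange (frobenius K p)) K = p ^ e)
    (b : Fin e → K)
    (hb : LinearIndependent ↥(RingHom.fieldRange (frobenius K p))
      (fun i : Fin e → Fin p => ∏ m : Fin e, b m ^ ((i m : ℕ)))) :
    ∃ D : (Fin e → ℕ) → K → K,
      (∀ j : Fin e → ℕ, ∀ n : ℕ, (∀ m : Fin e, j m ≤ n) →
        ∀ α : (Fin e → Fin (p ^ n)) → K,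
          D j (∑ i : Fin e → Fin (p ^ n), α i ^ (p ^ n) * ∏ m : Fin e, b m ^ ((i m : ℕ))) =
            ∑ i : Fin e → Fin (p ^ n),
              α i ^ (p ^ n) * wittDelta p e b (fun m => (i m : ℕ)) j) ∧
      IsWeDCF p e K D ∧
      (∀ i j : Fin e → ℕ, D j (∏ m : Fin e, b m ^ (i m)) = wittDelta p e b i j) := by
  have hb' := WittHS.IsPBasis.of_linearIndependent hdeg hb
  obtain ⟨Φ, h0, hΦ⟩ := WittHS.exists_expansion hb'
  have hmon : ∀ i j : Fin e → ℕ, MvPowerSeries.coeff (WittHS.toExp j) (Φ (∏ m, b m ^ i m)) =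
      wittDelta p e b i j := fun i j => by
    simp only [map_prod, map_pow, hΦ, WittHS.wittDelta_eq]
  refine ⟨fun j x => MvPowerSeries.coeff (WittHS.toExp j) (Φ x), fun j n hj α => ?_,
    ⟨hsc, hdeg, ?_, fun i x y => ?_, fun i x y => ?_, ?_, fun x => ?_⟩, hmon⟩
  · simp only [map_sum]
    refine Finset.sum_congr rfl fun i _ => ?_
    rw [map_mul, map_pow, WittHS.coeff_pow_mul_of_lt, h0, hmon]
    exact fun m => (hj m).trans_lt (Nat.lt_pow_self (Fact.out : p.Prime).one_lt)
  · funext x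
    have : WittHS.toExp (0 : Fin e → ℕ) = 0 := by
      ext k
      rfl
    simp only [this]
    exact h0 x
  · simp only [map_add]
  · classical
    simp only [map_mul, MvPowerSeries.coeff_mul]
    exact WittHS.sum_antidiagonal_toExp i fun u v =>
      MvPowerSeries.coeff u (Φ x) * MvPowerSeries.coeff v (Φ y)
  · exact WittHS.coeff_coeff_expansion hb' h0 hΦ
  · have hs : ∀ m : Fin e, WittHS.toExp (Pi.single m 1) = Finsupp.single m 1 := fun m => by
      ext k
      simp [Finsupp.single_apply]
    simp only [hs]
    exact WittHS.linearCoeff_eq_zero_iff hb' h0 hΦ x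
end
end

section
/- For every prime p and integer e ≥ 1, the L-theory SHF-bar_{p,e} is satisfiable (consistent); in particular its subtheory SHF'_{p,e} (axioms H0'–H7') is consistent. -/
noncomputable section

open FirstOrder FirstOrder.Language

/-- The language consisting of one unary function symbol `D_n` for each `n ∈ ℕ`. -/
def dLang : FirstOrder.Language :=
  { Functions := fun n => match n with | 1 => ℕ | _ => Empty
    Relations := fun _ => Empty }

/-- The language `L` of the theory `SHF-bar_{p,e}`: the language of rings `(+, *, -, 0, 1)`
augmented by a unary function symbol `D_n` for each `n ∈ ℕ`. -/
def shfLang : FirstOrder.Language := Language.ring.sum dLang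

/-- The unary function symbol `D_n` of `shfLang`. -/
def dSymb (n : ℕ) : shfLang.Functions 1 := Sum.inr n

/-- The interpretation of a function symbol of `shfLang` in a `shfLang`-structure. -/
def shfFun {M : Type*} [shfLang.Structure M] {n : ℕ} (f : shfLang.Functions n)
    (v : Fin n → M) : M :=
  Structure.funMap f v

/-- The interpretation of the symbol `D_n` in a `shfLang`-structure. -/
def shfD {M : Type*} [shfLang.Structure M] (n : ℕ) (x : M) : M :=
  shfFun (dSymb n) ![x]

/-- A `shfLang`-structure `M` is a model of `SHF-bar_{p,e}` iff:  the ring symbols are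
interpreted as the operations of a field structure on `M` of characteristic `p` (H0');
`M` is separably closed (H7', the scheme that every monic polynomial coprime to its formal
derivative has a root); and the operators `D_n := shfD n` satisfy `D_0 = id` and the axiom
schemes H1', H2', H3', H4', H5', H6' and H8'. -/
def IsSHFStructure (p e : ℕ) [Fact p.Prime] (M : Type*) [shfLang.Structure M] : Prop :=
  ∃ (_ : Field M) (_ : CharP M p),
    (∀ a b : M, shfFun (Sum.inl ringFunc.add) ![a, b] = a + b) ∧
    (∀ a b : M, shfFun (Sum.inl ringFunc.mul) ![a, b] = a * b) ∧
    (∀ a : M, shfFun (Sum.inl ringFunc.neg) ![a] = -a) ∧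
    (shfFun (Sum.inl ringFunc.zero) ![] = (0 : M)) ∧
    (shfFun (Sum.inl ringFunc.one) ![] = (1 : M)) ∧
    IsSepClosed M ∧
    (∀ x : M, shfD 0 x = x) ∧
    (∀ n : ℕ, ∀ x y : M, shfD n (x + y) = shfD n x + shfD n y) ∧
    (∀ n : ℕ, ∀ x y : M,
      shfD n (x * y) = ∑ k ∈ Finset.range (n + 1), shfD k x * shfD (n - k) y) ∧
    (∀ i j : ℕ, ∀ x : M, shfD i (shfD j x) = shfD j (shfD i x)) ∧
    (∀ n : ℕ, 1 ≤ n → ∀ x : M, (shfD n)^[p ^ e] x = 0) ∧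
    (∃ x : M, (shfD 1)^[p ^ e - 1] x ≠ 0) ∧
    (∀ x : M, shfD 1 x = 0 → ∃ y : M, x = y ^ p) ∧
    (∀ i j : Fin e → ℕ, ∀ x : M,
      hsComp p e shfD i (hsComp p e shfD j x) =
        ∑ᶠ l : Fin e → ℕ, ZMod.cast (wittAlpha p e i j l) * hsComp p e shfD l x)

/-- The theory `SHF-bar_{p,e}`, presented as the set of all of its logical consequences:
the set of `shfLang`-sentences true in every structure satisfying the axioms
H0'–H8' (as encoded by `IsSHFStructure`).  A theory presented this way has the same models,
and hence the same satisfiability, completeness and quantifier-elimination properties,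
as the axiom system H0'–H8' itself. -/
def shfTheory (p e : ℕ) [Fact p.Prime] : shfLang.Theory :=
  {σ : shfLang.Sentence |
    ∀ (M : Type) (_ : shfLang.Structure M), IsSHFStructure p e M → M ⊨ σ}

namespace SHF

section Extend

open MvPowerSeries Finset

variable {σ L : Type*} [CommRing L]

/-- The underlying function of `extend`. -/
def extendFun (T : L →+* MvPowerSeries σ L) (f : MvPowerSeries σ L) : MvPowerSeries σ L :=
  letI := Classical.decEq σ
  fun d => ∑ q ∈ antidiagonal d, coeff q.1 (T (coeff q.2 f))

theorem coeff_extendFun [DecidableEq σ] (T : L →+* MvPowerSeries σ L) (f : MvPowerSeries σ L)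
    (d : σ →₀ ℕ) :
    coeff d (extendFun T f) = ∑ q ∈ antidiagonal d, coeff q.1 (T (coeff q.2 f)) := by
  refine Finset.sum_congr ?_ fun _ _ => rfl
  rw [Subsingleton.elim (Classical.decEq σ) ‹DecidableEq σ›]

theorem extendFun_C (T : L →+* MvPowerSeries σ L) (a : L) : extendFun T (C a) = T a := by
  classical
  ext d
  rw [coeff_extendFun, sum_eq_single (d, 0)]
  · simp
  · rintro ⟨k, l⟩ h1 h2
    have : l ≠ 0 := by
      rintro rfl
      simp_all
    simp [coeff_C, this]
  · simp

theorem extendFun_mul (T : L →+* MvPowerSeries σ L) (f g : MvPowerSeries σ L) :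
    extendFun T (f * g) = extendFun T f * extendFun T g := by
  classical
  ext d
  simp only [coeff_extendFun, coeff_mul, map_sum, map_mul, sum_mul_sum, ← sum_product']
  simp only [sum_sigma']
  refine sum_nbij'
    (fun z => ⟨(z.2.2.1 + z.2.1.1, z.2.2.2 + z.2.1.2), ((z.2.2.1, z.2.1.1), (z.2.2.2, z.2.1.2))⟩)
    (fun z => ⟨(z.2.1.1 + z.2.2.1, z.2.1.2 + z.2.2.2), ((z.2.1.2, z.2.2.2), (z.2.1.1, z.2.2.1))⟩)
    ?_ ?_ ?_ ?_ ?_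
  · rintro ⟨⟨k, l⟩, ⟨⟨a, b⟩, ⟨c, d⟩⟩⟩ h
    simp only [mem_sigma, HasAntidiagonal.mem_antidiagonal, mem_product] at h ⊢
    obtain ⟨rfl, rfl, rfl⟩ := h
    exact ⟨by abel, by simp⟩
  · rintro ⟨⟨k, l⟩, ⟨⟨a, b⟩, ⟨c, d⟩⟩⟩ h
    simp only [mem_sigma, HasAntidiagonal.mem_antidiagonal, mem_product] at h ⊢
    obtain ⟨rfl, rfl, rfl⟩ := h
    exact ⟨by abel, by simp⟩
  · rintro ⟨⟨k, l⟩, ⟨⟨a, b⟩, ⟨c, d⟩⟩⟩ h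
    simp only [mem_sigma, HasAntidiagonal.mem_antidiagonal, mem_product] at h ⊢
    obtain ⟨rfl, rfl, rfl⟩ := h
    rfl
  · rintro ⟨⟨k, l⟩, ⟨⟨a, b⟩, ⟨c, d⟩⟩⟩ h
    simp only [mem_sigma, HasAntidiagonal.mem_antidiagonal, mem_product] at h ⊢
    obtain ⟨rfl, rfl, rfl⟩ := h
    rfl
  · rintro ⟨⟨k, l⟩, ⟨⟨a, b⟩, ⟨c, d⟩⟩⟩ h
    rfl

/-- The extension of a ring homomorphism `T : L → L⟦σ⟧` to `L⟦σ⟧` that fixes the variables and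
is continuous, i.e. `∑ f_d X^d ↦ ∑ T(f_d) X^d`. -/
def extend (T : L →+* MvPowerSeries σ L) : MvPowerSeries σ L →+* MvPowerSeries σ L where
  toFun := extendFun T
  map_one' := by simpa using extendFun_C T 1
  map_mul' := extendFun_mul T
  map_zero' := by simpa using extendFun_C T 0
  map_add' f g := by
    classical
    ext d
    simp [coeff_extendFun, sum_add_distrib]

theorem coeff_extend [DecidableEq σ] (T : L →+* MvPowerSeries σ L) (f : MvPowerSeries σ L)
    (d : σ →₀ ℕ) :
    coeff d (extend T f) = ∑ q ∈ antidiagonal d, coeff q.1 (T (coeff q.2 f)) :=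
  coeff_extendFun T f d

theorem extend_C (T : L →+* MvPowerSeries σ L) (a : L) : extend T (C a) = T a :=
  extendFun_C T a

theorem extend_X (T : L →+* MvPowerSeries σ L) (s : σ) : extend T (X s) = X s := by
  classical
  ext d
  rw [coeff_extend]
  simp only [coeff_X, apply_ite T, map_one, map_zero, apply_ite (coeff _), coeff_one]
  by_cases h : d = Finsupp.single s 1
  · subst h
    rw [sum_eq_single (0, Finsupp.single s 1)]
    · simp
    · rintro ⟨k, l⟩ h1 h2
      by_cases h3 : l = Finsupp.single s 1
      · subst h3
        simp_all
      · simp [h3]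
    · simp
  · rw [if_neg h]
    refine sum_eq_zero ?_
    rintro ⟨k, l⟩ h1
    by_cases h3 : l = Finsupp.single s 1
    · subst h3
      have : k ≠ 0 := by
        rintro rfl
        simp_all
      simp [this]
    · simp [h3]

/-- `T : L → L⟦σ⟧` is a section of the constant coefficient map. -/
def IsSec (T : L →+* MvPowerSeries σ L) : Prop := ∀ a, constantCoeff (T a) = a

theorem IsSec.extend_comp {T S : L →+* MvPowerSeries σ L} (hT : IsSec T) (hS : IsSec S) :
    IsSec ((extend T).comp S) := by
  classical
  intro a
  have := hS a
  rw [← coeff_zero_eq_constantCoeff_apply] at this ⊢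
  simp [coeff_extend, this, hT a]

theorem isSec_C : IsSec (C : L →+* MvPowerSeries σ L) := fun a => by simp

theorem IsSec.comp {τ : Type*} {T : L →+* MvPowerSeries σ L} (hT : IsSec T)
    (ρ : MvPowerSeries σ L →ₐ[L] MvPowerSeries τ L)
    (hρ : ∀ f, constantCoeff (ρ f) = constantCoeff f) :
    IsSec ((ρ : MvPowerSeries σ L →+* MvPowerSeries τ L).comp T) := fun a => by
  simpa [hρ] using hT a

theorem iInf_pow_ker_constantCoeff :
    ⨅ i : ℕ, (RingHom.ker (constantCoeff (σ := σ) (R := L))) ^ i = ⊥ := by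
  classical
  have key : ∀ i : ℕ, ∀ f ∈ (RingHom.ker (constantCoeff (σ := σ) (R := L))) ^ i,
      (i : ℕ∞) ≤ f.order := by
    intro i
    induction i with
    | zero => simp
    | succ i ih =>
      intro f hf
      rw [pow_succ] at hf
      refine Submodule.mul_induction_on hf ?_ ?_
      · intro a ha b hb
        refine le_trans ?_ (le_order_mul)
        push_cast
        refine add_le_add (ih a ha) ?_
        exact Order.one_le_iff_ne_zero.2 (order_ne_zero_iff_constCoeff_eq_zero.2 hb)
      · intro a b ha hb
        exact le_trans (le_min ha hb) (min_order_le_add)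
  refine (Submodule.eq_bot_iff _).2 fun f hf => ?_
  rw [← order_eq_top_iff]
  refine ENat.eq_top_iff_forall_ge.2 fun n => ?_
  exact key n f ((Submodule.mem_iInf _).1 hf n)

theorem IsSec.eq_of_eqOn {A : Type*} [CommRing A] [Algebra A L] [Algebra.FormallyUnramified A L]
    {T S : L →+* MvPowerSeries σ L} (hT : IsSec T) (hS : IsSec S)
    (h : ∀ a : A, T (algebraMap A L a) = S (algebraMap A L a)) : T = S := by
  let : Algebra A (MvPowerSeries σ L) := (T.comp (algebraMap A L)).toAlgebra
  let T' : L →ₐ[A] MvPowerSeries σ L := { T with commutes' := fun a => rfl }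
  let S' : L →ₐ[A] MvPowerSeries σ L := { S with commutes' := fun a => (h a).symm }
  have : T' = S' := by
    refine Algebra.FormallyUnramified.ext_of_iInf _ iInf_pow_ker_constantCoeff fun a => ?_
    rw [Ideal.Quotient.eq, RingHom.mem_ker, map_sub, sub_eq_zero]
    exact (hT a).trans (hS a).symm
  ext1 a
  exact congr($this a)

end Extend

section Translate

open MvPowerSeries WittVector

variable {p e : ℕ} [Fact p.Prime] {σ τ L : Type*} [CommRing L]
  [Algebra (MvPolynomial (Fin e) (ZMod p)) L]

variable (p e L) in
/-- The Witt vector over `L` whose first `e` components are the coordinate functions. -/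
def gen : WittVector p L :=
  WittVector.mk p fun i =>
    if h : i < e then algebraMap (MvPolynomial (Fin e) (ZMod p)) L (MvPolynomial.X ⟨i, h⟩) else 0

theorem gen_coeff (i : Fin e) :
    (gen p e L).coeff i = algebraMap (MvPolynomial (Fin e) (ZMod p)) L (MvPolynomial.X i) := by
  simp [gen]

theorem add_coeff_congr {R : Type*} [CommRing R] {n : ℕ} {x x' y y' : WittVector p R}
    (hx : ∀ i < n, x.coeff i = x'.coeff i) (hy : ∀ i < n, y.coeff i = y'.coeff i) :
    ∀ i < n, (x + y).coeff i = (x' + y').coeff i := by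
  have h1 : truncate n x = truncate n x' := by
    ext i
    simpa using hx i i.2
  have h2 : truncate n y = truncate n y' := by
    ext i
    simpa using hy i i.2
  intro i hi
  have : truncate n (x + y) = truncate n (x' + y') := by rw [map_add, map_add, h1, h2]
  have h := congr(TruncatedWittVector.coeff ⟨i, hi⟩ $this)
  rwa [coeff_truncate, coeff_truncate] at h

variable (p e) in
/-- `T` acts on the truncated generic Witt vector as the translation by `y`. -/
def Translates (T : L →+* MvPowerSeries σ L) (y : WittVector p (MvPowerSeries σ L)) : Prop :=
  ∀ i < e, T ((gen p e L).coeff i) = ((gen p e L).map C + y).coeff i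

theorem Translates.extend_comp {T S : L →+* MvPowerSeries σ L}
    {y z : WittVector p (MvPowerSeries σ L)}
    (hT : Translates p e T y) (hS : Translates p e S z) (hz : z.map (extend T) = z) :
    Translates p e ((extend T).comp S) (y + z) := by
  intro i hi
  rw [RingHom.comp_apply, hS i hi, ← WittVector.map_coeff, map_add, hz, ← add_assoc]
  refine add_coeff_congr (n := e) (fun j hj => ?_) (fun j hj => rfl) i hi
  rw [WittVector.map_coeff, WittVector.map_coeff, extend_C, hT j hj]

theorem Translates.comp {T : L →+* MvPowerSeries σ L} {y : WittVector p (MvPowerSeries σ L)}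
    (hT : Translates p e T y) (ρ : MvPowerSeries σ L →ₐ[L] MvPowerSeries τ L) :
    Translates p e ((ρ : MvPowerSeries σ L →+* MvPowerSeries τ L).comp T)
      (y.map (ρ : MvPowerSeries σ L →+* MvPowerSeries τ L)) := by
  intro i hi
  rw [RingHom.comp_apply, hT i hi, ← WittVector.map_coeff, map_add]
  refine add_coeff_congr (n := e) (fun j hj => ?_) (fun j hj => rfl) i hi
  simp only [WittVector.map_coeff]
  exact ρ.commutes _

theorem translates_C : Translates p e (C : L →+* MvPowerSeries σ L) 0 := by
  intro i _
  rw [add_zero, WittVector.map_coeff]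

theorem Translates.congr {T : L →+* MvPowerSeries σ L} {y z : WittVector p (MvPowerSeries σ L)}
    (hT : Translates p e T y) (h : ∀ i < e, y.coeff i = z.coeff i) : Translates p e T z :=
  fun i hi => (hT i hi).trans (add_coeff_congr (fun _ _ => rfl) h i hi)

theorem Translates.unique [Algebra.FormallyUnramified (MvPolynomial (Fin e) (ZMod p)) L]
    {T S : L →+* MvPowerSeries σ L} {y : WittVector p (MvPowerSeries σ L)}
    (hT : IsSec T) (hS : IsSec S) (h : Translates p e T y) (h' : Translates p e S y) : T = S := by
  refine hT.eq_of_eqOn hS (A := MvPolynomial (Fin e) (ZMod p)) fun a => ?_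
  have : T.comp (algebraMap (MvPolynomial (Fin e) (ZMod p)) L) =
      S.comp (algebraMap (MvPolynomial (Fin e) (ZMod p)) L) := by
    refine MvPolynomial.ringHom_ext' (Subsingleton.elim _ _) fun i => ?_
    rw [RingHom.comp_apply, RingHom.comp_apply, ← gen_coeff, h i i.2, h' i i.2]
  exact congr($this a)

variable (p e L) in
theorem exists_translates [Algebra (ZMod p) L]
    [Algebra.FormallySmooth (MvPolynomial (Fin e) (ZMod p)) L] :
    ∃ T : L →+* PowerSeries L, IsSec T ∧
      Translates p e T (teichmuller p (PowerSeries.X : PowerSeries L)) := by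
  let φ : MvPolynomial (Fin e) (ZMod p) →ₐ[ZMod p] PowerSeries L :=
    MvPolynomial.aeval fun i : Fin e =>
      ((gen p e L).map C + teichmuller p (PowerSeries.X : PowerSeries L)).coeff i
  have hφ : (PowerSeries.constantCoeff (R := L)).comp (φ : _ →+* PowerSeries L) =
      algebraMap (MvPolynomial (Fin e) (ZMod p)) L := by
    refine MvPolynomial.ringHom_ext' (Subsingleton.elim _ _) fun i => ?_
    rw [RingHom.comp_apply]
    have : (φ : MvPolynomial (Fin e) (ZMod p) →+* PowerSeries L) (MvPolynomial.X i) =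
        ((gen p e L).map C + teichmuller p (PowerSeries.X : PowerSeries L)).coeff i :=
      MvPolynomial.aeval_X _ i
    rw [this, ← WittVector.map_coeff, map_add, map_teichmuller, PowerSeries.constantCoeff_X,
      teichmuller_zero, add_zero, WittVector.map_coeff, WittVector.map_coeff, gen_coeff]
    exact constantCoeff_C _
  let : Algebra (MvPolynomial (Fin e) (ZMod p)) (PowerSeries L) :=
    (φ : _ →+* PowerSeries L).toAlgebra
  let I : Ideal (PowerSeries L) := .span {PowerSeries.X}
  let f : L →ₐ[MvPolynomial (Fin e) (ZMod p)] PowerSeries L ⧸ I :=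
    { (Ideal.Quotient.mk I).comp (PowerSeries.C (R := L)) with
      commutes' := fun a => by
        change Ideal.Quotient.mk I _ = Ideal.Quotient.mk I (φ a)
        rw [Ideal.Quotient.eq, Ideal.mem_span_singleton, PowerSeries.X_dvd_iff, ← hφ]
        simp }
  obtain ⟨g, hg⟩ := Algebra.FormallySmooth.exists_mkₐ_comp_eq_of_isAdicComplete f
  refine ⟨g, fun a => ?_, fun i hi => ?_⟩
  · have h1 : Ideal.Quotient.mk I (g a) = Ideal.Quotient.mk I (PowerSeries.C a) := congr($hg a)
    rw [Ideal.Quotient.eq, Ideal.mem_span_singleton, PowerSeries.X_dvd_iff, map_sub,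
      sub_eq_zero] at h1
    exact h1.trans (by simp)
  · lift i to Fin e using hi
    rw [gen_coeff]
    exact (g.commutes _).trans (MvPolynomial.aeval_X _ i)

end Translate

section Commute

open MvPowerSeries WittVector

variable {α β τ L : Type*} [CommRing L]

/-- Renaming of variables along an embedding preserves the constant coefficient. -/
theorem IsSec.rename {T : L →+* MvPowerSeries α L} (hT : IsSec T) (g : α ↪ τ) :
    IsSec ((MvPowerSeries.rename (R := L) g : MvPowerSeries α L →+* MvPowerSeries τ L).comp T) :=
  hT.comp _ fun f => constantCoeff_rename g f

theorem coeff_extend_rename (g : α ↪ τ) (h : β ↪ τ) (hgh : ∀ a b, g a ≠ h b)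
    (T : L →+* MvPowerSeries α L) (f : MvPowerSeries β L) (i : α →₀ ℕ) (j : β →₀ ℕ) :
    coeff (i.embDomain g + j.embDomain h)
      (extend ((MvPowerSeries.rename (R := L) g : MvPowerSeries α L →+* MvPowerSeries τ L).comp T)
        (MvPowerSeries.rename h f)) = coeff i (T (coeff j f)) := by
  classical
  rw [coeff_extend, Finset.sum_eq_single (i.embDomain g, j.embDomain h)]
  · simp only [coeff_embDomain_rename, RingHom.comp_apply]
    exact coeff_embDomain_rename g _ i
  · rintro ⟨k, l⟩ hkl hne
    rw [Finset.HasAntidiagonal.mem_antidiagonal] at hkl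
    simp only at hkl ⊢
    by_cases hl : l ∈ Set.range (Finsupp.mapDomain h)
    · obtain ⟨l, rfl⟩ := hl
      by_cases hk : k ∈ Set.range (Finsupp.mapDomain g)
      · obtain ⟨k, rfl⟩ := hk
        rw [← Finsupp.embDomain_eq_mapDomain, ← Finsupp.embDomain_eq_mapDomain] at hkl hne
        refine absurd ?_ hne
        have h1 : k = i := by
          ext a
          have hnot : g a ∉ Set.range h := by
            rintro ⟨b, hb⟩
            exact hgh a b hb.symm
          have := congr($hkl (g a))
          simpa [Finsupp.embDomain_apply_self,
            Finsupp.embDomain_of_notMem_range _ _ _ hnot] using this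
        have h2 : l = j := by
          ext b
          have hnot : h b ∉ Set.range g := by
            rintro ⟨a, ha⟩
            exact hgh a b ha
          have := congr($hkl (h b))
          simpa [Finsupp.embDomain_apply_self,
            Finsupp.embDomain_of_notMem_range _ _ _ hnot] using this
        rw [h1, h2]
      · exact coeff_rename_eq_zero _ _ hk
    · rw [coeff_rename_eq_zero _ _ hl, map_zero, map_zero]
  · intro h
    exact absurd (by simp) h

variable {p e : ℕ} [Fact p.Prime] [Algebra (MvPolynomial (Fin e) (ZMod p)) L]
  [Algebra.FormallyUnramified (MvPolynomial (Fin e) (ZMod p)) L]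

theorem coeff_comm {T : L →+* PowerSeries L} (hT : IsSec T)
    (h : Translates p e T (teichmuller p (PowerSeries.X : PowerSeries L))) (i j : ℕ) (a : L) :
    PowerSeries.coeff i (T (PowerSeries.coeff j (T a))) =
      PowerSeries.coeff j (T (PowerSeries.coeff i (T a))) := by
  let g : Fin 2 → Unit ↪ Fin 2 := fun s => ⟨fun _ => s, fun _ _ _ => rfl⟩
  let S : Fin 2 → L →+* MvPowerSeries (Fin 2) L := fun s =>
    (MvPowerSeries.rename (R := L) (g s) : MvPowerSeries Unit L →+* MvPowerSeries (Fin 2) L).comp T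
  have hS : ∀ s, IsSec (S s) := fun s => hT.rename (g s)
  have hS' : ∀ s, Translates p e (S s) (teichmuller p (X s)) := by
    intro s
    have := h.comp (MvPowerSeries.rename (R := L) (g s))
    rw [map_teichmuller] at this
    have h2 : (MvPowerSeries.rename (R := L) (g s)) (PowerSeries.X : PowerSeries L) = X s :=
      rename_X _ _
    exact h2 ▸ this
  have hfix : ∀ s t, (teichmuller p (X t)).map (extend (S s)) = teichmuller p (X t) := by
    intro s t
    rw [map_teichmuller, extend_X]
  have hcomm : (extend (S 0)).comp (S 1) = (extend (S 1)).comp (S 0) := by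
    refine Translates.unique ((hS 0).extend_comp (hS 1)) ((hS 1).extend_comp (hS 0))
      ((hS' 0).extend_comp (hS' 1) (hfix 0 1)) ?_
    rw [add_comm]
    exact (hS' 1).extend_comp (hS' 0) (hfix 1 0)
  have h1 := coeff_extend_rename (g 0) (g 1) (fun _ _ => (zero_ne_one : (0 : Fin 2) ≠ 1)) T (T a)
    (Finsupp.single () i) (Finsupp.single () j)
  have h2 := coeff_extend_rename (g 1) (g 0) (fun _ _ => (one_ne_zero : (1 : Fin 2) ≠ 0)) T (T a)
    (Finsupp.single () j) (Finsupp.single () i)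
  rw [add_comm] at h2
  refine h1.symm.trans (Eq.trans ?_ h2)
  exact congr(coeff _ ($hcomm a))

end Commute

section Rep

open MvPowerSeries WittVector

variable {σ τ R L : Type*} [CommRing R] [CommRing L] [Module R L]

/-- The coefficients of `T` are given by the operators that are the coefficients of `u`. -/
def Rep (u : MvPowerSeries σ R) (T : L →+* MvPowerSeries σ L) : Prop :=
  ∀ a d, coeff d (T a) = coeff d u • a

theorem Rep.mul {u v : MvPowerSeries σ R} {T S : L →+* MvPowerSeries σ L} (hT : Rep u T)
    (hS : Rep v S) : Rep (u * v) ((extend T).comp S) := by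
  classical
  intro a d
  rw [RingHom.comp_apply, coeff_extend, coeff_mul, Finset.sum_smul]
  refine Finset.sum_congr rfl fun q _ => ?_
  rw [hT, hS, mul_smul]

theorem rep_one : Rep (1 : MvPowerSeries σ R) (C : L →+* MvPowerSeries σ L) := by
  classical
  intro a d
  rw [coeff_C, coeff_one, ite_smul, one_smul, zero_smul]

theorem Rep.rename {u : MvPowerSeries σ R} {T : L →+* MvPowerSeries σ L} (hT : Rep u T)
    (g : σ ↪ τ) : Rep (MvPowerSeries.rename g u)
      ((MvPowerSeries.rename (R := L) g : MvPowerSeries σ L →+* MvPowerSeries τ L).comp T) := by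
  intro a d
  change coeff d (MvPowerSeries.rename g (T a)) = _
  by_cases hd : d ∈ Set.range (Finsupp.mapDomain g)
  · obtain ⟨d, rfl⟩ := hd
    rw [← Finsupp.embDomain_eq_mapDomain, coeff_embDomain_rename, coeff_embDomain_rename, hT]
  · rw [coeff_rename_eq_zero _ _ hd, coeff_rename_eq_zero _ _ hd, zero_smul]

theorem expand_injective {q : ℕ} (hq : q ≠ 0) :
    Function.Injective (MvPowerSeries.expand (σ := σ) (R := L) q hq) := by
  intro f g h
  ext d
  rw [← coeff_expand_smul q hq f, h, coeff_expand_smul]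

theorem Rep.of_expand {q : ℕ} (hq : q ≠ 0) {u : MvPowerSeries σ R} {S : L →+* MvPowerSeries σ L}
    (hS : Rep (MvPowerSeries.expand q hq u) S) :
    ∃ T : L →+* MvPowerSeries σ L, Rep u T ∧ ∀ a, MvPowerSeries.expand q hq (T a) = S a := by
  let F : L → MvPowerSeries σ L := fun a d => coeff d u • a
  have hF : ∀ a d, coeff d (F a) = coeff d u • a := fun a d => rfl
  have key : ∀ a, MvPowerSeries.expand q hq (F a) = S a := by
    intro a
    ext d
    rw [hS]
    by_cases h : ∀ i, q ∣ d i
    · obtain ⟨d, rfl⟩ : ∃ d', d = q • d' := by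
        refine ⟨d.mapRange (· / q) (Nat.zero_div q), ?_⟩
        ext i
        simp [Nat.mul_div_cancel' (h i)]
      rw [coeff_expand_smul, coeff_expand_smul, hF]
    · push Not at h
      obtain ⟨i, hi⟩ := h
      rw [coeff_expand_of_not_dvd q hq _ hi, coeff_expand_of_not_dvd q hq _ hi, zero_smul]
  have inj := expand_injective (σ := σ) (L := L) hq
  refine ⟨{ toFun := F
            map_one' := inj (by rw [key, map_one, map_one])
            map_mul' := fun a b => inj (by simp only [map_mul, key])
            map_zero' := inj (by rw [key, map_zero, map_zero])
            map_add' := fun a b => inj (by simp only [map_add, key]) }, hF, key⟩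

end Rep

section MonoW

open MvPowerSeries WittVector

variable {p : ℕ} {R S : Type*} [CommRing R] [CommRing S]

variable (p) in
/-- The Witt vector all of whose coefficients vanish except the `m`-th one, which is `f`. -/
def monoW (m : ℕ) (f : R) : WittVector p R := WittVector.mk p fun i => if i = m then f else 0

theorem monoW_coeff (m i : ℕ) (f : R) : (monoW p m f).coeff i = if i = m then f else 0 := rfl

variable [Fact p.Prime]

theorem map_monoW (φ : R →+* S) (m : ℕ) (f : R) : (monoW p m f).map φ = monoW p m (φ f) := by
  ext i
  rw [WittVector.map_coeff, monoW_coeff, monoW_coeff, apply_ite φ, map_zero]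

theorem pow_nsmul_teichmuller [CharP R p] (m : ℕ) (f : R) :
    p ^ m • teichmuller p f = monoW p m (f ^ p ^ m) := by
  ext i
  rw [monoW_coeff, nsmul_eq_mul, mul_comm, Nat.cast_pow]
  split_ifs with h
  · rw [h, teichmuller_mul_pow_coeff]
  · rw [teichmuller_mul_pow_coeff_of_ne _ h]

theorem sum_monoW_coeff {e : ℕ} (s : Finset (Fin e)) (f : Fin e → R) (i : Fin e) :
    (∑ m ∈ s, monoW p m (f m)).coeff i = if i ∈ s then f i else 0 := by
  rw [sum_coeff_eq_coeff_sum]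
  · simp [monoW_coeff, Fin.val_inj]
  · intro n
    refine ⟨?_⟩
    rintro ⟨a, _, ha⟩ ⟨b, _, hb⟩
    simp only [monoW_coeff, ne_eq, ite_eq_right_iff, not_forall, exists_prop] at ha hb
    exact Subtype.ext (Fin.ext (ha.1.symm.trans hb.1))

end MonoW

section RepTranslates

open MvPowerSeries WittVector

variable {p e : ℕ} [Fact p.Prime] {σ R L : Type*} [CommRing R] [CommRing L] [Module R L]
  [Algebra (MvPolynomial (Fin e) (ZMod p)) L]

theorem Rep.pow {u : MvPowerSeries σ R} {T : L →+* MvPowerSeries σ L}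
    {y : WittVector p (MvPowerSeries σ L)} (hu : Rep u T) (hT : IsSec T)
    (h : Translates p e T y) (hy : y.map (extend T) = y) (n : ℕ) :
    ∃ S, Rep (u ^ n) S ∧ IsSec S ∧ Translates p e S (n • y) := by
  induction n with
  | zero =>
    refine ⟨C, ?_, isSec_C, ?_⟩
    · rw [pow_zero]
      exact rep_one
    · rw [zero_nsmul]
      exact translates_C
  | succ n ih =>
    obtain ⟨S, h1, h2, h3⟩ := ih
    refine ⟨(extend T).comp S, ?_, hT.extend_comp h2, ?_⟩
    · rw [pow_succ']
      exact hu.mul h1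
    · rw [succ_nsmul']
      exact h.extend_comp h3 (by rw [map_nsmul, hy])

variable [CharP R p] [CharP L p]

theorem Rep.exists_frobenius {u : PowerSeries R} {T : L →+* PowerSeries L}
    (hu : Rep (R := R) u T) (hT : IsSec T)
    (h : Translates p e T (teichmuller p (PowerSeries.X : PowerSeries L))) (m : ℕ) :
    ∃ S : L →+* PowerSeries L, Rep (R := R) (MvPowerSeries.map (iterateFrobenius R p m) u) S ∧
      IsSec S ∧ Translates p e S (monoW p m (PowerSeries.X : PowerSeries L)) := by
  have hp : p ≠ 0 := (Fact.out : p.Prime).ne_zero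
  have hq : p ^ m ≠ 0 := pow_ne_zero m hp
  have : CharP (PowerSeries L) p :=
    charP_of_injective_ringHom (f := (PowerSeries.C : L →+* _)) PowerSeries.C_injective p
  obtain ⟨S, h1, h2, h3⟩ := Rep.pow hu hT h (by
    rw [map_teichmuller]
    exact congrArg _ (extend_X _ _))
    (p ^ m)
  rw [← map_iterateFrobenius_expand p hp, map_expand] at h1
  obtain ⟨T', h4, h5⟩ := h1.of_expand hq
  refine ⟨T', h4, fun a => ?_, fun i hi => expand_injective hq ?_⟩
  · rw [← constantCoeff_expand _ hq, h5, h2]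
  · rw [h5, h3 i hi, pow_nsmul_teichmuller]
    change _ = ((MvPowerSeries.expand (σ := Unit) (R := L) (p ^ m) hq :
      PowerSeries L →+* PowerSeries L)) _
    rw [← WittVector.map_coeff, map_add, map_monoW]
    refine add_coeff_congr (n := e) (fun j _ => ?_) (fun j _ => ?_) i hi
    · simp only [WittVector.map_coeff]
      exact (expand_C _ hq _).symm
    · rw [monoW_coeff, monoW_coeff]
      refine if_congr Iff.rfl ?_ rfl
      exact (expand_X _ hq _).symm

theorem Rep.exists_prod {u : PowerSeries R} {T : L →+* PowerSeries L}
    (hu : Rep (R := R) u T) (hT : IsSec T)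
    (h : Translates p e T (teichmuller p (PowerSeries.X : PowerSeries L))) (s : Finset (Fin e)) :
    ∃ S : L →+* MvPowerSeries (Fin e) L,
      Rep (∏ m ∈ s, MvPowerSeries.rename (fun _ : Unit => m)
        (MvPowerSeries.map (iterateFrobenius R p m) u)) S ∧
      IsSec S ∧ Translates p e S (∑ m ∈ s, monoW p m (X m)) := by
  classical
  induction s using Finset.induction_on with
  | empty => exact ⟨C, rep_one, isSec_C, translates_C⟩
  | insert m s hm ih =>
    obtain ⟨S, h1, h2, h3⟩ := ih
    obtain ⟨T', h4, h5, h6⟩ := hu.exists_frobenius hT h m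
    let g : Unit ↪ Fin e := ⟨fun _ => m, fun _ _ _ => rfl⟩
    refine ⟨(extend _).comp S, ?_, (h5.rename g).extend_comp h2, ?_⟩
    · rw [Finset.prod_insert hm]
      exact (h4.rename g).mul h1
    · rw [Finset.sum_insert hm]
      refine Translates.extend_comp ?_ h3 ?_
      · have := h6.comp (MvPowerSeries.rename (R := L) g)
        rw [map_monoW] at this
        have h2 : (MvPowerSeries.rename (R := L) g) (PowerSeries.X : PowerSeries L) = X m :=
          rename_X _ _
        exact h2 ▸ this
      · simp only [map_sum, map_monoW, extend_X]

theorem coeff_prod_rename [Fintype σ] (u : σ → PowerSeries R) (v : σ →₀ ℕ) :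
    coeff v (∏ m, MvPowerSeries.rename (fun _ : Unit => m) (u m)) =
      ∏ m, PowerSeries.coeff (v m) (u m) := by
  classical
  have key : ∀ (m : σ) (w : σ →₀ ℕ), coeff w (MvPowerSeries.rename (fun _ : Unit => m) (u m)) =
      if w = Finsupp.single m (w m) then PowerSeries.coeff (w m) (u m) else 0 := by
    intro m w
    let g : Unit ↪ σ := ⟨fun _ => m, fun _ _ _ => rfl⟩
    split_ifs with h
    · have : w = (Finsupp.single () (w m)).embDomain g := by
        rw [Finsupp.embDomain_single]
        exact h
      conv_lhs => rw [this]
      exact coeff_embDomain_rename g _ _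
    · refine coeff_rename_eq_zero _ _ ?_
      rintro ⟨k, rfl⟩
      refine h ?_
      rw [show k = Finsupp.single () (k ()) from Finsupp.unique_ext (by simp)]
      simp
  rw [coeff_prod, Finset.sum_eq_single
    (Finsupp.equivFunOnFinite.symm fun m => Finsupp.single m (v m))]
  · refine Finset.prod_congr rfl fun m _ => ?_
    rw [key]
    simp
  · intro l hl hne
    rw [Finset.mem_finsuppAntidiag] at hl
    by_contra h0
    have h1 : ∀ m, l m = Finsupp.single m (l m m) := by
      intro m
      by_contra h2
      refine h0 (Finset.prod_eq_zero (Finset.mem_univ m) ?_)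
      rw [key, if_neg h2]
    refine hne (Finsupp.ext fun m => ?_)
    rw [h1 m, ← hl.1]
    change _ = Finsupp.single m _
    congr 1
    rw [Finset.sum_apply', Finset.sum_eq_single m]
    · intro b _ hb
      rw [h1 b, Finsupp.single_eq_of_ne (Ne.symm hb)]
    · simp
  · intro h
    refine absurd ?_ h
    rw [Finset.mem_finsuppAntidiag]
    refine ⟨?_, by simp⟩
    ext m
    simp

end RepTranslates

section WittGroupLaw

open MvPowerSeries WittVector

variable {p e : ℕ} [Fact p.Prime] {R L : Type*} [CommRing R] [CommRing L] [Module R L]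
  [Algebra (MvPolynomial (Fin e) (ZMod p)) L] [CharP L p]

theorem Rep.pow_smul_eq_zero [CharP R p]
    [Algebra.FormallyUnramified (MvPolynomial (Fin e) (ZMod p)) L]
    {u : PowerSeries R} {T : L →+* PowerSeries L} (hu : Rep (R := R) u T) (hT : IsSec T)
    (h : Translates p e T (teichmuller p (PowerSeries.X : PowerSeries L))) {m n : ℕ}
    (hm : e ≤ m) (hn : n ≠ 0) (a : L) : PowerSeries.coeff n u ^ p ^ m • a = 0 := by
  obtain ⟨S, h1, h2, h3⟩ := hu.exists_frobenius hT h m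
  have h4 : S = (MvPowerSeries.C : L →+* MvPowerSeries Unit L) :=
    Translates.unique h2 isSec_C (h3.congr fun i hi => by
      rw [monoW_coeff, if_neg (by lia), zero_coeff]) translates_C
  have h5 := h1 a (Finsupp.single () n)
  rw [h4] at h5
  have h6 : PowerSeries.coeff n (PowerSeries.C a) = PowerSeries.coeff n u ^ p ^ m • a := h5
  rw [← h6, PowerSeries.coeff_C, if_neg hn]

variable (p L) in
/-- The inclusion of the polynomials over the prime field into the power series over `L`. -/
def ofPrimePoly (τ : Type*) : MvPolynomial τ (ZMod p) →+* MvPowerSeries τ L :=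
  MvPolynomial.coeToMvPowerSeries.ringHom.comp (MvPolynomial.map (ZMod.castHom (dvd_refl p) L))

theorem coeff_ofPrimePoly {τ : Type*} (P : MvPolynomial τ (ZMod p)) (d : τ →₀ ℕ) :
    coeff d (ofPrimePoly p L τ P) = ZMod.cast (P.coeff d) := by
  rw [ofPrimePoly, RingHom.comp_apply, MvPolynomial.coeToMvPowerSeries.ringHom_apply,
    MvPolynomial.coeff_coe, MvPolynomial.coeff_map, ZMod.castHom_apply]

theorem ofPrimePoly_X {τ : Type*} (s : τ) : ofPrimePoly p L τ (MvPolynomial.X s) = X s := by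
  rw [ofPrimePoly, RingHom.comp_apply, MvPolynomial.map_X,
    MvPolynomial.coeToMvPowerSeries.ringHom_apply, MvPolynomial.coe_X]

theorem constantCoeff_ofPrimePoly_wittHmod (m : ℕ) :
    constantCoeff (ofPrimePoly p L (Fin 2 × ℕ) (wittHmod p m)) = 0 := by
  rw [← coeff_zero_eq_constantCoeff_apply, coeff_ofPrimePoly, ← MvPolynomial.constantCoeff_eq,
    wittHmod, MvPolynomial.constantCoeff_map, constantCoeff_wittAdd, map_zero, ZMod.cast_zero]

theorem generic_add_coeff (m : ℕ) :
    (WittVector.mk p (fun i => X (0, i)) + WittVector.mk p (fun i => X (1, i)) :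
      WittVector p (MvPowerSeries (Fin 2 × ℕ) L)).coeff m = ofPrimePoly p L _ (wittHmod p m) := by
  have key : MvPolynomial.eval₂Hom (Int.castRingHom (MvPowerSeries (Fin 2 × ℕ) L)) X =
      (ofPrimePoly p L (Fin 2 × ℕ)).comp (MvPolynomial.map (Int.castRingHom (ZMod p))) := by
    refine MvPolynomial.ringHom_ext' (Subsingleton.elim _ _) fun s => ?_
    simp [ofPrimePoly_X]
  have h2 : Function.uncurry ![(WittVector.mk p (fun i => X (0, i)) :
      WittVector p (MvPowerSeries (Fin 2 × ℕ) L)).coeff, (WittVector.mk p (fun i => X (1, i)) :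
      WittVector p (MvPowerSeries (Fin 2 × ℕ) L)).coeff] = X := by
    ext1 ⟨s, i⟩
    fin_cases s <;> rfl
  rw [add_coeff, peval, wittHmod, h2]
  refine Eq.trans ?_ congr($key (wittAdd p m))
  change MvPolynomial.eval₂ _ X _ = MvPolynomial.eval₂ _ X _
  congr 1

variable (e) in
/-- The inclusion of the `s`-th copy of `Fin e` into the variables of the Witt polynomials. -/
def copy (s : Fin 2) : Fin e ↪ Fin 2 × ℕ := ⟨fun m => (s, m), fun _ _ h => Fin.ext congr(($h).2)⟩

theorem xyExp_eq (i j : Fin e → ℕ) :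
    xyExp e i j = (Finsupp.equivFunOnFinite.symm i).embDomain (copy e 0) +
      (Finsupp.equivFunOnFinite.symm j).embDomain (copy e 1) := by
  have : ∀ (s : Fin 2) (i : Fin e → ℕ), (Finsupp.equivFunOnFinite.symm i).embDomain (copy e s) =
      ∑ m : Fin e, Finsupp.single (s, (m : ℕ)) (i m) := by
    intro s i
    rw [Finsupp.embDomain_eq_mapDomain,
      ← Finsupp.univ_sum_single (Finsupp.equivFunOnFinite.symm i), Finsupp.mapDomain_finsetSum]
    refine Finset.sum_congr rfl fun m _ => ?_
    rw [Finsupp.mapDomain_single]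
    rfl
  rw [this, this, ← Finset.sum_add_distrib]
  rfl

theorem constantCoeff_subst_eq {σ τ : Type*} {H : σ → MvPowerSeries τ L} (hH : HasSubst H)
    (h0 : ∀ m, constantCoeff (H m) = 0) (f : MvPowerSeries σ L) :
    constantCoeff (substAlgHom (R := L) hH f) = constantCoeff f := by
  have h1 : f = C (constantCoeff f) + (f - C (constantCoeff f)) := by ring
  have h2 : constantCoeff (substAlgHom (R := L) hH (f - C (constantCoeff f))) = 0 := by
    rw [substAlgHom_apply]
    exact constantCoeff_subst_eq_zero hH h0 (by simp)
  conv_lhs => rw [h1]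
  rw [map_add, map_add, h2, add_zero, show (C (constantCoeff f) : MvPowerSeries σ L) =
    algebraMap L _ (constantCoeff f) from rfl, AlgHom.commutes]
  exact constantCoeff_C _

theorem coeff_coeff_eq_finsum [Algebra.FormallyUnramified (MvPolynomial (Fin e) (ZMod p)) L]
    {T : L →+* MvPowerSeries (Fin e) L} (hT : IsSec T)
    (h : Translates p e T (∑ m : Fin e, monoW p m (X m))) (i j : Fin e → ℕ) (a : L) :
    coeff (Finsupp.equivFunOnFinite.symm i) (T (coeff (Finsupp.equivFunOnFinite.symm j) (T a))) =
      ∑ᶠ l : Fin e → ℕ, ZMod.cast (wittAlpha p e i j l) *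
        coeff (Finsupp.equivFunOnFinite.symm l) (T a) := by
  let H : Fin e → MvPowerSeries (Fin 2 × ℕ) L := fun m => ofPrimePoly p L _ (wittHmod p m)
  have h0 : ∀ m, constantCoeff (H m) = 0 := fun m => constantCoeff_ofPrimePoly_wittHmod _
  have hH : HasSubst H := hasSubst_of_constantCoeff_zero h0
  let S : Fin 2 → L →+* MvPowerSeries (Fin 2 × ℕ) L := fun s =>
    (MvPowerSeries.rename (R := L) (copy e s) : MvPowerSeries _ L →+* MvPowerSeries _ L).comp T
  have hS : ∀ s, IsSec (S s) := fun s => hT.rename (copy e s)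
  have hS' : ∀ s, Translates p e (S s) (∑ m : Fin e, monoW p m (X (s, (m : ℕ)))) := by
    intro s
    have := h.comp (MvPowerSeries.rename (R := L) (copy e s))
    rw [map_sum] at this
    simp only [map_monoW] at this
    have h2 : ∀ m : Fin e, (MvPowerSeries.rename (R := L) (copy e s)) (X m) = X (s, (m : ℕ)) :=
      fun m => rename_X _ _
    simpa only [RingHom.coe_coe, h2] using this
  let Φ : MvPowerSeries (Fin e) L →ₐ[L] MvPowerSeries (Fin 2 × ℕ) L := substAlgHom hH
  have key : (extend (S 0)).comp (S 1) =
      (Φ : MvPowerSeries (Fin e) L →+* MvPowerSeries (Fin 2 × ℕ) L).comp T := by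
    have h2 := (hS' 0).extend_comp (hS' 1) (by simp only [map_sum, map_monoW, extend_X])
    have h3 := h.comp Φ
    refine Translates.unique ((hS 0).extend_comp (hS 1)) (hT.comp _ (constantCoeff_subst_eq hH h0))
      h2 (h3.congr fun m hm => ?_)
    lift m to Fin e using hm
    have h1 : ∀ s : Fin 2, ∀ m < e, (∑ m : Fin e, monoW p m
        (X (s, (m : ℕ)) : MvPowerSeries (Fin 2 × ℕ) L)).coeff m =
        (WittVector.mk p fun i => (X (s, i) : MvPowerSeries (Fin 2 × ℕ) L)).coeff m := by
      intro s m hm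
      lift m to Fin e using hm
      rw [sum_monoW_coeff, if_pos (Finset.mem_univ _)]
      rfl
    rw [add_coeff_congr (h1 0) (h1 1) m m.2, generic_add_coeff, WittVector.map_coeff,
      sum_monoW_coeff, if_pos (Finset.mem_univ _)]
    exact substAlgHom_X hH m
  have h1 := coeff_extend_rename (copy e 0) (copy e 1)
    (fun _ _ h => zero_ne_one (α := Fin 2) congr(($h).1)) T (T a)
    (Finsupp.equivFunOnFinite.symm i) (Finsupp.equivFunOnFinite.symm j)
  rw [← h1, ← xyExp_eq]
  refine Eq.trans congr(coeff _ ($key a)) ?_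
  change coeff _ (substAlgHom hH (T a)) = _
  rw [substAlgHom_apply, coeff_subst hH,
    ← finsum_comp_equiv (Finsupp.equivFunOnFinite (α := Fin e) (M := ℕ)).symm]
  refine finsum_congr fun l => ?_
  rw [smul_eq_mul, mul_comm]
  congr 1
  rw [wittAlpha, ← coeff_ofPrimePoly (L := L), Finsupp.prod_fintype _ _ (by simp),
    map_prod (ofPrimePoly p L _)]
  simp only [map_pow (ofPrimePoly p L _)]
  rfl

end WittGroupLaw

section Operators

open MvPowerSeries WittVector

universe v

variable {p e : ℕ} {L : Type v} [CommRing L]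

/-- The `n`-th component of `T`, as a map `L → L`. -/
def comp (T : L →+* PowerSeries L) (n : ℕ) (a : L) : L := PowerSeries.coeff n (T a)

theorem Rep.comp_iterate {R : Type*} [CommRing R] [Module R L] {u : PowerSeries R}
    {T : L →+* PowerSeries L} (hu : Rep (R := R) u T) (n k : ℕ) (a : L) :
    (comp T n)^[k] a = PowerSeries.coeff n u ^ k • a := by
  induction k with
  | zero => simp
  | succ k ih =>
    rw [Function.iterate_succ_apply', ih, pow_succ', mul_smul]
    exact hu _ _

theorem Rep.hsComp_comp {R : Type*} [CommRing R] [Module R L] {u : PowerSeries R}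
    {T : L →+* PowerSeries L} (hu : Rep (R := R) u T) (v : Fin e → ℕ) (a : L) :
    hsComp p e (comp T) v a = (∏ m : Fin e, PowerSeries.coeff (v m) u ^ p ^ (m : ℕ)) • a := by
  have key : ∀ l : List (Fin e),
      (l.map fun m : Fin e => (comp T (v m))^[p ^ (m : ℕ)]).foldr (· ∘ ·) id a =
      (l.map fun m : Fin e => PowerSeries.coeff (v m) u ^ p ^ (m : ℕ)).prod • a := by
    intro l
    induction l with
    | nil => simp
    | cons m l ih =>
      rw [List.map_cons, List.foldr_cons, Function.comp_apply, ih, hu.comp_iterate, List.map_cons,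
        List.prod_cons, mul_smul]
  rw [hsComp, ← List.prod_ofFn, List.ofFn_eq_map, List.ofFn_eq_map]
  exact key _

variable [Fact p.Prime] [CharP L p] [Algebra (MvPolynomial (Fin e) (ZMod p)) L]
  [Algebra.FormallyUnramified (MvPolynomial (Fin e) (ZMod p)) L]

open scoped IsMulCommutative in
theorem exists_rep [Nontrivial L] {T : L →+* PowerSeries L} (hT : IsSec T)
    (h : Translates p e T (teichmuller p (PowerSeries.X : PowerSeries L))) :
    ∃ (R : Type v) (_ : CommRing R) (_ : CharP R p) (_ : Module R L) (u : PowerSeries R),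
      Rep (R := R) u T := by
  let : Algebra (ZMod p) L := ZMod.algebra L p
  let D : ℕ → Module.End (ZMod p) L := fun n =>
    AddMonoidHom.toZModLinearMap p
      ((PowerSeries.coeff (R := L) n).toAddMonoidHom.comp T.toAddMonoidHom)
  have hD : ∀ n a, D n a = PowerSeries.coeff n (T a) := fun n a => rfl
  let R := Algebra.adjoin (ZMod p) (Set.range D)
  have : IsMulCommutative R := by
    refine Algebra.isMulCommutative_adjoin _ ?_
    rintro _ ⟨i, rfl⟩ _ ⟨j, rfl⟩
    exact LinearMap.ext fun a => coeff_comm hT h i j a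
  refine ⟨R, inferInstance, charP_of_injective_algebraMap (algebraMap (ZMod p) R).injective p,
    inferInstance, PowerSeries.mk fun n => ⟨D n, Algebra.subset_adjoin ⟨n, rfl⟩⟩, ?_⟩
  intro a d
  rw [show d = Finsupp.single () (d ()) from Finsupp.unique_ext (by simp)]
  change _ = PowerSeries.coeff (d ()) _ • a
  rw [PowerSeries.coeff_mk]
  rfl

variable [Nontrivial L] {T : L →+* PowerSeries L}

theorem comp_iterate_eq_zero (hT : IsSec T)
    (h : Translates p e T (teichmuller p (PowerSeries.X : PowerSeries L)))
    {n m : ℕ} (hn : n ≠ 0) (hm : e ≤ m) (a : L) : (comp T n)^[p ^ m] a = 0 := by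
  obtain ⟨R, _, _, _, u, hu⟩ := exists_rep hT h
  rw [hu.comp_iterate, hu.pow_smul_eq_zero hT h hm hn]

theorem exists_frobenius (hT : IsSec T)
    (h : Translates p e T (teichmuller p (PowerSeries.X : PowerSeries L))) (m : ℕ) :
    ∃ S : L →+* PowerSeries L, IsSec S ∧
      Translates p e S (monoW p m (PowerSeries.X : PowerSeries L)) ∧
      ∀ n a, comp S n a = (comp T n)^[p ^ m] a := by
  obtain ⟨R, _, _, _, u, hu⟩ := exists_rep hT h
  obtain ⟨S, h1, h2, h3⟩ := hu.exists_frobenius hT h m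
  refine ⟨S, h2, h3, fun n a => ?_⟩
  rw [hu.comp_iterate]
  exact h1 _ _

theorem hsComp_hsComp (hT : IsSec T)
    (h : Translates p e T (teichmuller p (PowerSeries.X : PowerSeries L)))
    (i j : Fin e → ℕ) (a : L) :
    hsComp p e (comp T) i (hsComp p e (comp T) j a) =
      ∑ᶠ l : Fin e → ℕ, ZMod.cast (wittAlpha p e i j l) * hsComp p e (comp T) l a := by
  obtain ⟨R, _, _, _, u, hu⟩ := exists_rep hT h
  obtain ⟨S, h1, h2, h3⟩ := hu.exists_prod hT h Finset.univ
  have key : ∀ (v : Fin e → ℕ) (a : L),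
      hsComp p e (comp T) v a = coeff (Finsupp.equivFunOnFinite.symm v) (S a) := by
    intro v a
    rw [h1, coeff_prod_rename, hu.hsComp_comp]
    rfl
  simp only [key]
  exact coeff_coeff_eq_finsum h2 h3 i j a

end Operators

section Derivations

variable {L : Type*} [Field L]

theorem iterate_derivation_natCast_mul (Δ : Derivation ℤ L L) (k n : ℕ) (w : L) :
    Δ^[k] (n * w) = n * Δ^[k] w := by
  induction k with
  | zero => rfl
  | succ k ih => simp [Function.iterate_succ_apply', ih, Derivation.leibniz]

theorem iterate_derivation_mul_pow (Δ : Derivation ℤ L L) {x : L} (hx : Δ x = 1) (n : ℕ) :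
    ∀ w : L, Δ w = 0 → Δ^[n] (w * x ^ n) = n.factorial * w := by
  induction n with
  | zero => simp
  | succ n ih =>
    intro w hw
    have h1 : Δ (w * x ^ (n + 1)) = ((n + 1 : ℕ) * w) * x ^ n := by
      rw [Derivation.leibniz, Derivation.leibniz_pow, hw, hx]
      simp only [Nat.add_sub_cancel, smul_eq_mul, nsmul_eq_mul]
      ring
    rw [Function.iterate_succ_apply, h1, ih _ (by simp [Derivation.leibniz, hw]),
      Nat.factorial_succ]
    push_cast
    ring

variable {p : ℕ}

open Polynomial in
theorem eq_C_of_derivative_eq_zero {M : Type*} [CommRing M] [IsDomain M] [CharP M p] {q : M[X]}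
    (hq : q.natDegree < p) (h : derivative q = 0) : q = C (q.coeff 0) := by
  refine eq_C_of_natDegree_eq_zero ?_
  by_contra h0
  have h1 := congr(coeff $h (q.natDegree - 1))
  rw [coeff_derivative, Nat.sub_add_cancel (by lia), coeff_zero, mul_eq_zero] at h1
  rcases h1 with h1 | h1
  · rw [coeff_natDegree, leadingCoeff_eq_zero] at h1
    simp [h1] at h0
  · rw [← Nat.cast_add_one, Nat.sub_add_cancel (by lia), CharP.cast_eq_zero_iff M p] at h1
    exact absurd (Nat.le_of_dvd (by lia) h1) (by lia)

open Polynomial in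
theorem eq_zero_of_aeval_eq_zero {M : Type*} [CommRing M] [IsDomain M] [CharP M p] [Algebra M L]
    [FaithfulSMul M L] (Δ : Derivation M L L) {x : L} (hx : Δ x = 1) (n : ℕ) (hn : n < p) :
    ∀ q : M[X], q.natDegree ≤ n → aeval x q = 0 → q = 0 := by
  have key : ∀ q : M[X], q.natDegree < p → derivative q = 0 → aeval x q = 0 → q = 0 := by
    intro q h1 h2 h3
    have h4 := eq_C_of_derivative_eq_zero h1 h2
    rw [h4, aeval_C, map_eq_zero_iff _ (FaithfulSMul.algebraMap_injective M L)] at h3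
    rw [h4, h3, C_0]
  induction n with
  | zero =>
    intro q hq h
    refine key q (by lia) ?_ h
    rw [eq_C_of_natDegree_le_zero hq, derivative_C]
  | succ n ih =>
    intro q hq h
    refine key q (by lia) (ih (by lia) _ ?_ ?_) h
    · exact (natDegree_derivative_le q).trans (by lia)
    · have := Δ.map_aeval q x
      rwa [h, map_zero, hx, smul_eq_mul, mul_one, eq_comm] at this

variable [Fact p.Prime] [CharP L p]

theorem exists_iterate_derivation_ne_zero {e : ℕ} {Δ : ℕ → Derivation ℤ L L} {x : ℕ → L}
    (hΔ : ∀ m a, Δ m a = (Δ 0)^[p ^ m] a) (h0 : ∀ i m, i < m → m < e → Δ m (x i) = 0)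
    (h1 : ∀ m < e, Δ m (x m) = 1) {k : ℕ} (hk : k ≤ e) :
    ∃ w : L, (∀ j, k ≤ j → j < e → Δ j w = 0) ∧ (Δ 0)^[p ^ k - 1] w ≠ 0 := by
  have hp : p.Prime := Fact.out
  induction k with
  | zero => exact ⟨1, by simp, by simp⟩
  | succ k ih =>
    obtain ⟨w, hw, hw'⟩ := ih (by lia)
    refine ⟨w * x k ^ (p - 1), fun j hj hj' => ?_, ?_⟩
    · rw [Derivation.leibniz, Derivation.leibniz_pow, h0 k j hj hj', hw j (by lia) hj']
      simp
    · have h2 : p ^ (k + 1) - 1 = (p ^ k - 1) + p ^ k * (p - 1) := by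
        have : p ^ k * (p - 1) = p ^ (k + 1) - p ^ k := by rw [Nat.mul_sub, mul_one, pow_succ]
        have h3 : 0 < p ^ k := pow_pos hp.pos k
        have h4 : p ^ k ≤ p ^ (k + 1) := Nat.pow_le_pow_right hp.pos (by lia)
        lia
      have h3 : (Δ 0)^[p ^ k * (p - 1)] = (Δ k)^[p - 1] := by
        rw [Function.iterate_mul]
        congr 1
        ext a
        exact (hΔ k a).symm
      rw [h2, Function.iterate_add_apply, h3, iterate_derivation_mul_pow _ (h1 k (by lia)) _ _
        (hw k le_rfl (by lia)), iterate_derivation_natCast_mul]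
      refine mul_ne_zero ?_ hw'
      rw [Ne, CharP.cast_eq_zero_iff L p, hp.dvd_factorial]
      have := hp.pos
      lia

/-- A derivation killing a subalgebra is linear over that subalgebra. -/
def derivationOver {F : Type*} [Field F] [Algebra F L] (Δ : Derivation ℤ L L)
    (M : Subalgebra F L) (hM : ∀ a ∈ M, Δ a = 0) : Derivation M L L where
  toFun := Δ
  map_add' := map_add Δ
  map_smul' c a := by
    change Δ (c * a) = c * Δ a
    simp [Derivation.leibniz, hM c c.2]
  map_one_eq_zero' := Δ.map_one_eq_zero
  leibniz' := Δ.leibniz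

open Polynomial in
theorem mem_adjoin_of_derivation_eq_zero {F : Type*} [Field F] [Algebra F L] {s : Set L} {x a : L}
    (Δ : Derivation ℤ L L) (hF : ∀ c : F, Δ (algebraMap F L c) = 0) (hs : ∀ y ∈ s, Δ y = 0)
    (hx : Δ x = 1) (hx' : x ^ p ∈ (algebraMap F L).range)
    (ha : a ∈ Algebra.adjoin F (insert x s)) (ha' : Δ a = 0) : a ∈ Algebra.adjoin F s := by
  have hp : p.Prime := Fact.out
  let M := Algebra.adjoin F s
  have hM : ∀ a ∈ M, Δ a = 0 := by
    intro a ha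
    induction ha using Algebra.adjoin_induction with
    | mem y hy => exact hs y hy
    | algebraMap c => exact hF c
    | add y z _ _ hy hz => rw [map_add, hy, hz, add_zero]
    | mul y z _ _ hy hz => rw [Derivation.leibniz, hy, hz, smul_zero, smul_zero, add_zero]
  have : CharP M p := RingHom.charP M.val.toRingHom Subtype.val_injective p
  let Δ' := derivationOver Δ M hM
  rw [Set.insert_eq, Set.union_comm, Algebra.adjoin_union_eq_adjoin_adjoin,
    Subalgebra.mem_restrictScalars, Algebra.adjoin_singleton_eq_range_aeval] at ha
  obtain ⟨q, rfl⟩ := ha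
  obtain ⟨c, hc⟩ := hx'
  let f : M[X] := X ^ p - C (algebraMap F M c)
  have hf : f.Monic := monic_X_pow_sub_C _ hp.ne_zero
  have hfx : aeval x f = 0 := by
    simp only [f, map_sub, map_pow, aeval_X, aeval_C, sub_eq_zero]
    rw [← hc]
    rfl
  have hdeg : (q %ₘ f).natDegree < p := by
    refine (natDegree_modByMonic_lt q hf ?_).trans_eq (natDegree_X_pow_sub_C)
    intro h
    have := natDegree_X_pow_sub_C (R := M) (n := p) (r := algebraMap F M c)
    rw [show X ^ p - C (algebraMap F M c) = 1 from h, natDegree_one] at this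
    exact hp.ne_zero this.symm
  have hq : aeval x (q %ₘ f) = aeval x q := aeval_modByMonic_eq_self_of_root hfx
  change Δ (aeval x q) = 0 at ha'
  change aeval x q ∈ M
  rw [← hq] at ha' ⊢
  clear_value f
  have h2 : derivative (q %ₘ f) = 0 := by
    refine eq_zero_of_aeval_eq_zero Δ' hx (p - 1) (by have := hp.pos; lia) _
      ((natDegree_derivative_le _).trans (Nat.sub_le_sub_right hdeg.le 1)) ?_
    have := Δ'.map_aeval (q %ₘ f) x
    rw [show Δ' (aeval x (q %ₘ f)) = 0 from ha', show Δ' x = 1 from hx, smul_eq_mul,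
      mul_one] at this
    exact this.symm
  rw [eq_C_of_derivative_eq_zero hdeg h2, aeval_C]
  exact Subtype.prop _

theorem exists_pow_eq_of_derivation_eq_zero {e : ℕ} {Δ : ℕ → Derivation ℤ L L} {x : ℕ → L}
    (hΔ : ∀ m a, Δ m a = (Δ 0)^[p ^ m] a) (h0 : ∀ i m, i < m → m < e → Δ m (x i) = 0)
    (h1 : ∀ m < e, Δ m (x m) = 1)
    (htop : Algebra.adjoin (frobenius L p).fieldRange (x '' Set.Iio e) = ⊤)
    {a : L} (ha : Δ 0 a = 0) : ∃ y, a = y ^ p := by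
  have hp : p.Prime := Fact.out
  have ha' : ∀ m, Δ m a = 0 := by
    intro m
    obtain ⟨k, hk⟩ := Nat.exists_eq_add_of_lt (pow_pos hp.pos m)
    rw [hΔ, hk, zero_add, Function.iterate_succ_apply, ha]
    exact iterate_map_zero (Δ 0) _
  have key : ∀ k, ∀ m, m + k = e →
      a ∈ Algebra.adjoin (frobenius L p).fieldRange (x '' Set.Iio m) := by
    intro k
    induction k with
    | zero =>
      rintro m rfl
      exact htop ▸ trivial
    | succ k ih =>
      intro m hm
      have h2 := ih (m + 1) (by lia)
      rw [← Order.succ_eq_add_one, Order.Iio_succ_eq_insert, Set.image_insert_eq] at h2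
      refine mem_adjoin_of_derivation_eq_zero (p := p) (Δ m) ?_ ?_ (h1 m (by lia)) ?_ h2 (ha' m)
      · rintro ⟨_, y, rfl⟩
        change Δ m (y ^ p) = 0
        rw [Derivation.leibniz_pow]
        simp
      · rintro _ ⟨i, hi, rfl⟩
        exact h0 i m hi (by lia)
      · exact ⟨⟨x m ^ p, x m, rfl⟩, rfl⟩
  have h2 := key e 0 (zero_add e)
  rw [← Nat.bot_eq_zero, Set.Iio_bot, Set.image_empty, Algebra.adjoin_empty, Algebra.mem_bot] at h2
  obtain ⟨⟨_, y, rfl⟩, rfl⟩ := h2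
  exact ⟨y, rfl⟩

end Derivations

section WittCoordinates

open WittVector

theorem add_coeff_of_coeff_eq_zero {p : ℕ} [Fact p.Prime] {R : Type*} [CommRing R] {m : ℕ}
    (x y : WittVector p R) (hy : ∀ i < m, y.coeff i = 0) :
    (x + y).coeff m = x.coeff m + y.coeff m := by
  have hx : init m x + tail m x = x := init_add_tail x m
  have hd : ∀ n, (init m x).coeff n = 0 ∨ (tail m x + y).coeff n = 0 := by
    intro n
    rcases lt_or_ge n m with h | h
    · right
      have := add_coeff_congr (n := m) (x := tail m x) (x' := 0) (y := y) (y' := 0)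
        (fun i hi => by simp [tail, select, hi]) (fun i hi => by simp [hy i hi]) n h
      simpa using this
    · left
      simp [init, select, h]
  have h1 : (x + y).coeff m = (tail m x + y).coeff m := by
    rw [← hx, add_assoc, coeff_add_of_disjoint _ _ _ hd, hx]
    simp [init, select]
  have h2 : x.coeff m = (tail m x).coeff m := by simp [tail, select]
  obtain ⟨t, ht⟩ : ∃ t, tail m x = verschiebung^[m] t :=
    ⟨_, eq_iterate_verschiebung fun i hi => by simp [tail, select, hi]⟩
  obtain ⟨s, rfl⟩ : ∃ t, y = verschiebung^[m] t := ⟨_, eq_iterate_verschiebung hy⟩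
  have hc : ∀ z : WittVector p R, (verschiebung^[m] z).coeff m = z.coeff 0 := fun z => by
    simpa using iterate_verschiebung_coeff z m 0
  rw [h1, h2, ht, ← iterate_map_add, hc, hc, hc, add_coeff_zero]

end WittCoordinates

section Sections

variable {L : Type*} [CommRing L]

theorem comp_zero {T : L →+* PowerSeries L} (hT : IsSec T) (a : L) : comp T 0 a = a := by
  rw [comp, PowerSeries.coeff_zero_eq_constantCoeff]
  exact hT a

theorem comp_mul (T : L →+* PowerSeries L) (n : ℕ) (a b : L) :
    comp T n (a * b) = ∑ k ∈ Finset.range (n + 1), comp T k a * comp T (n - k) b := by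
  simp only [comp]
  rw [map_mul, PowerSeries.coeff_mul, Finset.Nat.sum_antidiagonal_eq_sum_range_succ_mk]

/-- The linear component of a section, as a derivation. -/
def derivationOfSec {T : L →+* PowerSeries L} (hT : IsSec T) : Derivation ℤ L L where
  toFun := comp T 1
  map_add' a b := by simp [comp]
  map_smul' c a :=
    map_zsmul ((PowerSeries.coeff (R := L) 1).toAddMonoidHom.comp T.toAddMonoidHom) c a
  map_one_eq_zero' := by
    change comp T 1 1 = 0
    simp [comp, PowerSeries.coeff_one]
  leibniz' a b := by
    change comp T 1 (a * b) = a * comp T 1 b + b * comp T 1 a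
    rw [comp_mul, Finset.sum_range_succ, Finset.sum_range_one]
    simp only [Nat.sub_zero, Nat.sub_self, comp_zero hT]
    ring

variable {p e : ℕ} [Fact p.Prime] [Algebra (MvPolynomial (Fin e) (ZMod p)) L]

theorem Translates.comp_one_gen_coeff_of_lt {S : L →+* PowerSeries L} {m : ℕ}
    (h : Translates p e S (monoW p m (PowerSeries.X : PowerSeries L))) {i : ℕ} (hi : i < m)
    (hm : m < e) : SHF.comp S 1 ((gen p e L).coeff i) = 0 := by
  rw [SHF.comp, h i (hi.trans hm), add_coeff_congr (n := m) (x := (gen p e L).map MvPowerSeries.C)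
    (fun _ _ => rfl) (y' := 0) (fun j hj => by simp [monoW_coeff, hj.ne]) i hi, add_zero,
    WittVector.map_coeff]
  exact (PowerSeries.coeff_C _ _).trans (by simp)

theorem Translates.comp_one_gen_coeff_self {S : L →+* PowerSeries L} {m : ℕ}
    (h : Translates p e S (monoW p m (PowerSeries.X : PowerSeries L))) (hm : m < e) :
    SHF.comp S 1 ((gen p e L).coeff m) = 1 := by
  rw [SHF.comp, h m hm, add_coeff_of_coeff_eq_zero _ _
    (fun j hj => by simp [monoW_coeff, hj.ne]), monoW_coeff, if_pos rfl, map_add,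
    WittVector.map_coeff, PowerSeries.coeff_one_X, add_eq_right]
  exact (PowerSeries.coeff_C _ _).trans (by simp)

end Sections

theorem adjoin_gen_eq_top (p e : ℕ) [Fact p.Prime] (K : Type*) {L : Type*} [Field K] [Field L]
    [CharP L p] [Algebra (MvPolynomial (Fin e) (ZMod p)) K]
    [Algebra (MvPolynomial (Fin e) (ZMod p)) L] [Algebra K L]
    [IsScalarTower (MvPolynomial (Fin e) (ZMod p)) K L]
    [IsFractionRing (MvPolynomial (Fin e) (ZMod p)) K] [Algebra.IsSeparable K L] :
    Algebra.adjoin (frobenius L p).fieldRange ((gen p e L).coeff '' Set.Iio e) = ⊤ := by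
  have hp : p.Prime := Fact.out
  let F := (frobenius L p).fieldRange
  let A := MvPolynomial (Fin e) (ZMod p)
  have hF : ∀ a : L, a ^ p ∈ F := fun a => ⟨a, rfl⟩
  have : Algebra.IsAlgebraic F L := by
    refine ⟨fun a => (IsIntegral.of_pow hp.pos ?_).isAlgebraic⟩
    exact isIntegral_algebraMap (x := (⟨a ^ p, hF a⟩ : F))
  let S : Set L := (gen p e L).coeff '' Set.Iio e
  let N := IntermediateField.adjoin F S
  have hFN : ∀ a ∈ F, a ∈ N := fun a ha => N.algebraMap_mem ⟨a, ha⟩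
  have hA : ∀ a : A, algebraMap A L a ∈ N := by
    intro a
    induction a using MvPolynomial.induction_on with
    | C c =>
      refine hFN _ ⟨algebraMap A L (MvPolynomial.C c), ?_⟩
      rw [frobenius_def, ← map_pow, ← map_pow, ZMod.pow_card]
    | add a b ha hb =>
      rw [map_add]
      exact add_mem ha hb
    | mul_X a i ha =>
      rw [map_mul]
      exact mul_mem ha (IntermediateField.subset_adjoin _ _ ⟨i, i.2, gen_coeff i⟩)
  have hK : ∀ a : K, algebraMap K L a ∈ N := by
    intro a
    obtain ⟨b, c, -, rfl⟩ := IsFractionRing.div_surjective A a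
    rw [map_div₀, ← IsScalarTower.algebraMap_apply, ← IsScalarTower.algebraMap_apply]
    exact div_mem (hA b) (hA c)
  have hKp : CharP K p := (RingHom.charP_iff (algebraMap K L) (algebraMap K L).injective p).2 ‹_›
  have : ExpChar K p := .prime hp
  have hN : N = ⊤ := by
    rw [eq_top_iff]
    intro a _
    have h1 := IntermediateField.adjoin_eq_adjoin_pow_expChar_of_isSeparable' K L Set.univ p
    rw [IntermediateField.adjoin_univ] at h1
    have h2 : a ∈ IntermediateField.adjoin K ((· ^ p) '' (Set.univ : Set L)) := h1 ▸ trivial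
    have h3 : (IntermediateField.adjoin K ((· ^ p) '' (Set.univ : Set L))).toSubfield ≤
        N.toSubfield := by
      rw [IntermediateField.adjoin_toSubfield, Subfield.closure_le, Set.union_subset_iff]
      constructor
      · rintro _ ⟨b, rfl⟩
        exact hK b
      · rintro _ ⟨b, -, rfl⟩
        exact hFN _ (hF b)
    exact h3 h2
  rw [← IntermediateField.adjoin_toSubalgebra_of_isAlgebraic fun x _ =>
    Algebra.IsAlgebraic.isAlgebraic x, show IntermediateField.adjoin F S = ⊤ from hN,
    IntermediateField.top_toSubalgebra]

section Model

/-- The `shfLang`-structure on a ring given by its operations and a sequence of operators. -/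
@[reducible]
def structureOf {L : Type*} [CommRing L] (D : ℕ → L → L) : shfLang.Structure L where
  funMap {n} f := match n, f with
    | _, Sum.inl ringFunc.add => fun v => v 0 + v 1
    | _, Sum.inl ringFunc.mul => fun v => v 0 * v 1
    | _, Sum.inl ringFunc.neg => fun v => -v 0
    | _, Sum.inl ringFunc.zero => fun _ => 0
    | _, Sum.inl ringFunc.one => fun _ => 1
    | 1, Sum.inr k => fun v => D k (v 0)
  RelMap _ _ := False

variable {p e : ℕ} [Fact p.Prime]

theorem isSHFStructure_of_translates (K : Type*) {L : Type*} [Field K] [Field L]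
    [CharP L p] [Algebra (MvPolynomial (Fin e) (ZMod p)) K]
    [Algebra (MvPolynomial (Fin e) (ZMod p)) L] [Algebra K L]
    [IsScalarTower (MvPolynomial (Fin e) (ZMod p)) K L]
    [IsFractionRing (MvPolynomial (Fin e) (ZMod p)) K] [Algebra.IsSeparable K L]
    [Algebra.FormallyUnramified (MvPolynomial (Fin e) (ZMod p)) L] [IsSepClosed L]
    {T : L →+* PowerSeries L} (hT : IsSec T)
    (h : Translates p e T (WittVector.teichmuller p (PowerSeries.X : PowerSeries L))) :
    letI := structureOf (comp T)
    IsSHFStructure p e L := by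
  let := structureOf (comp T)
  choose S hS hS' hST using exists_frobenius hT h
  let Δ : ℕ → Derivation ℤ L L := fun m => derivationOfSec (hS m)
  have hΔ' : ∀ m a, Δ m a = (comp T 1)^[p ^ m] a := fun m => hST m 1
  have hΔ0 : ⇑(Δ 0) = comp T 1 := funext fun a => by simp [hΔ']
  have hΔ : ∀ m a, Δ m a = (Δ 0)^[p ^ m] a := fun m a => by rw [hΔ', hΔ0]
  have h0 : ∀ i m, i < m → m < e → Δ m ((gen p e L).coeff i) = 0 :=
    fun i m hi hm => (hS' m).comp_one_gen_coeff_of_lt hi hm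
  have h1 : ∀ m < e, Δ m ((gen p e L).coeff m) = 1 :=
    fun m hm => (hS' m).comp_one_gen_coeff_self hm
  refine ⟨inferInstance, inferInstance, fun _ _ => rfl, fun _ _ => rfl, fun _ => rfl, rfl, rfl,
    inferInstance, comp_zero hT, fun n x y => ?_, comp_mul T, coeff_comm hT h, fun n hn x => ?_,
    ?_, fun x hx => ?_, hsComp_hsComp hT h⟩
  · change comp T n (x + y) = comp T n x + comp T n y
    simp [comp]
  · exact comp_iterate_eq_zero hT h (by lia) le_rfl x
  · obtain ⟨w, -, hw⟩ := exists_iterate_derivation_ne_zero hΔ h0 h1 le_rfl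
    rw [hΔ0] at hw
    exact ⟨w, hw⟩
  · refine exists_pow_eq_of_derivation_eq_zero hΔ h0 h1 (adjoin_gen_eq_top p e K) ?_
    rw [hΔ0]
    exact hx

variable (p e) in
theorem exists_isSHFStructure :
    ∃ (L : Type) (_ : shfLang.Structure L), IsSHFStructure p e L := by
  let A := MvPolynomial (Fin e) (ZMod p)
  let K := FractionRing A
  let L := SeparableClosure K
  have : CharP K p := charP_of_injective_algebraMap (IsFractionRing.injective A K) p
  have : CharP L p := charP_of_injective_algebraMap (algebraMap K L).injective p
  have : Algebra.FormallyEtale A K := .of_isLocalization (nonZeroDivisors A)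
  have : Algebra.FormallyEtale K L := .of_isSeparable K L
  have : Algebra.FormallyEtale A L := .comp A K L
  let : Algebra (ZMod p) L := ZMod.algebra L p
  obtain ⟨T, hT, h⟩ := exists_translates p e L
  exact ⟨L, _, isSHFStructure_of_translates K hT h⟩

end Model

end SHF

/-- The theory `SHF-bar_{p,e}` is consistent (satisfiable); in particular its subtheory
`SHF'_{p,e}` (axioms H0'–H7') is consistent. -/
theorem shfTheory_isSatisfiable (p e : ℕ) [Fact p.Prime] (he : 1 ≤ e) :
    (shfTheory p e).IsSatisfiable := by
  obtain ⟨L, _, h⟩ := SHF.exists_isSHFStructure p e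
  have : L ⊨ shfTheory p e := ⟨fun σ hσ => hσ L _ h⟩
  obtain ⟨_, _, -⟩ := h
  exact Theory.Model.isSatisfiable L
end
end
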